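/- Let f_t be the bounded weak solution of the topological Cucker–Smale equation on [0,T] with initial datum f₀ ∈ L^∞(ℝ^d × ℝ^d) supported in B_{R_x} × B_{R_v}. Let (X^f_i(t),V^f_i(t)), i = 1,…,N, solve the intermediate system Ẋ^f_i = V^f_i, V̇^f_i = W[Sf_t, ν^N_t](X^f_i, V^f_i), where ν^N_t := (1/N) Σ_k δ_{X^f_k(t)} δ_{V^f_k(t)}, with initial data (x_i,v_i) ∈ B_{R_x} × B_{R_v}, and set μ^N₀ := (1/N) Σ_i δ_{x_i} δ_{v_i}. Then for all t ∈ [0,T], W₁(f_t, ν^N_t) ≤ C(T) W₁(f₀, μ^N₀), where C(T) depends only on T, R_x, R_v and ‖f₀‖_∞. -/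

import Mathlib

open MeasureTheory Metric Set
open scoped ENNReal

noncomputable section

/-- `M[ρ](x,r) = ∫_{|x'−x| ≤ r} ρ(x') dx'`. -/
def Mdens {d : ℕ} (ρ : EuclideanSpace ℝ (Fin d) → ℝ)
    (x : EuclideanSpace ℝ (Fin d)) (r : ℝ) : ℝ :=
  ∫ y in closedBall x r, ρ y

/-- The spatial marginal `Sf(x) = ∫ f(x,v) dv`. -/
def Smarg {d : ℕ} (f : EuclideanSpace ℝ (Fin d) × EuclideanSpace ℝ (Fin d) → ℝ)
    (x : EuclideanSpace ℝ (Fin d)) : ℝ :=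
  ∫ w, f (x, w)

/-- The interaction field
`W[ρ,f](x,v) = ∫ K(M[ρ](x,|x−y|)) (w−v) f(y,w) dy dw`. -/
def Wfield {d : ℕ} (K : ℝ → ℝ) (ρ : EuclideanSpace ℝ (Fin d) → ℝ)
    (f : EuclideanSpace ℝ (Fin d) × EuclideanSpace ℝ (Fin d) → ℝ)
    (x v : EuclideanSpace ℝ (Fin d)) : EuclideanSpace ℝ (Fin d) :=
  ∫ p : EuclideanSpace ℝ (Fin d) × EuclideanSpace ℝ (Fin d),
    (K (Mdens ρ x (dist x p.1)) * f p) • (p.2 - v)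

/-- The interaction field against a measure `ν`:
`W[ρ,ν](x,v) = ∫ K(M[ρ](x,|x−y|)) (w−v) dν(y,w)`. -/
def WfieldMeas {d : ℕ} (K : ℝ → ℝ) (ρ : EuclideanSpace ℝ (Fin d) → ℝ)
    (ν : Measure (EuclideanSpace ℝ (Fin d) × EuclideanSpace ℝ (Fin d)))
    (x v : EuclideanSpace ℝ (Fin d)) : EuclideanSpace ℝ (Fin d) :=
  ∫ p, K (Mdens ρ x (dist x p.1)) • (p.2 - v) ∂ν

/-- The `1`-Wasserstein distance, via duality with bounded `1`-Lipschitz functions. -/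
def W1 {E : Type*} [MeasurableSpace E] [PseudoMetricSpace E] (μ ν : Measure E) : ℝ :=
  sSup {a : ℝ | ∃ φ : E → ℝ, LipschitzWith 1 φ ∧ (∃ C : ℝ, ∀ x, |φ x| ≤ C) ∧
    a = (∫ x, φ x ∂μ) - ∫ x, φ x ∂ν}

/-- The empirical measure `(1/N) Σ_i δ_{x_i} δ_{v_i}` on phase space. -/
def empPair {d N : ℕ} (x v : Fin N → EuclideanSpace ℝ (Fin d)) :
    Measure (EuclideanSpace ℝ (Fin d) × EuclideanSpace ℝ (Fin d)) :=
  ((N : ℝ≥0∞))⁻¹ • ∑ i : Fin N, Measure.dirac (x i, v i)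

/-- A family `{f_t}_{t∈[0,T]}` of bounded probability densities, weakly continuous
in `t`, which is a weak solution of the topological Cucker–Smale equation with
initial datum `f₀`. -/
def IsWeakSolCS {d : ℕ} (K : ℝ → ℝ) (T : ℝ)
    (f₀ : EuclideanSpace ℝ (Fin d) × EuclideanSpace ℝ (Fin d) → ℝ)
    (f : ℝ → EuclideanSpace ℝ (Fin d) × EuclideanSpace ℝ (Fin d) → ℝ) : Prop :=
  (∀ t ∈ Set.Icc 0 T, Measurable (f t) ∧ (∀ p, 0 ≤ f t p) ∧ (∫ p, f t p) = 1) ∧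
  (∃ C : ℝ, ∀ t ∈ Set.Icc 0 T, ∀ᵐ p ∂volume, f t p ≤ C) ∧
  (∀ α : EuclideanSpace ℝ (Fin d) × EuclideanSpace ℝ (Fin d) → ℝ,
    Continuous α → (∃ C : ℝ, ∀ p, |α p| ≤ C) →
    ContinuousOn (fun t => ∫ p, α p * f t p) (Set.Icc 0 T)) ∧
  (∃ Z : ℝ → EuclideanSpace ℝ (Fin d) × EuclideanSpace ℝ (Fin d) →
      EuclideanSpace ℝ (Fin d) × EuclideanSpace ℝ (Fin d),
    (∀ p, Z 0 p = p) ∧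
    (∀ p, ∀ t ∈ Set.Icc 0 T,
      HasDerivWithinAt (fun τ => (Z τ p).1) ((Z t p).2) (Set.Icc 0 T) t ∧
      HasDerivWithinAt (fun τ => (Z τ p).2)
        (Wfield K (Smarg (f t)) (f t) (Z t p).1 (Z t p).2) (Set.Icc 0 T) t) ∧
    (∀ t ∈ Set.Icc 0 T,
      ∀ α : EuclideanSpace ℝ (Fin d) × EuclideanSpace ℝ (Fin d) → ℝ,
        Continuous α → (∃ C : ℝ, ∀ p, |α p| ≤ C) →
        (∫ p, α p * f t p) = ∫ p, α (Z t p) * f₀ p))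

set_option linter.unusedSectionVars false

theorem exists_open_of_closed_cover {F : Set ℝ} (hF : IsClosed F) (hne : F.Nonempty)
    {ι : Type*} [Countable ι] {A : ι → Set ℝ} (hA : ∀ i, IsClosed (A i))
    (hcov : F ⊆ ⋃ i, A i) :
    ∃ i, ∃ τ ∈ F, ∃ η > 0, ∀ t ∈ F, |t - τ| < η → t ∈ A i := by
  have : CompleteSpace F := hF.completeSpace_coe
  have : Nonempty F := hne.to_subtype
  obtain ⟨i, ⟨τ, hτ⟩⟩ := nonempty_interior_of_iUnion_of_closed
    (f := fun i => ((↑) : F → ℝ) ⁻¹' A i)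
    (fun i => (hA i).preimage continuous_subtype_val)
    (by
      ext x
      simpa using hcov x.2)
  rw [mem_interior_iff_mem_nhds, Metric.mem_nhds_iff] at hτ
  obtain ⟨η, hη, hsub⟩ := hτ
  refine ⟨i, τ, τ.2, η, hη, fun t ht h => ?_⟩
  exact hsub (show (⟨t, ht⟩ : F) ∈ ball τ η by
    simpa [Subtype.dist_eq, Real.dist_eq] using h)

theorem exists_bound_of_locally_bounded {m : ℝ → ℝ≥0∞} {S : Set ℝ} (hS : IsCompact S)
    (h : ∀ x ∈ S, ∃ c ≠ ∞, ∀ᶠ s in nhds x, s ∈ S → m s ≤ c) :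
    ∃ c ≠ ∞, ∀ t ∈ S, m t ≤ c := by
  refine hS.induction_on (p := fun A => ∃ c ≠ ∞, ∀ t ∈ A, m t ≤ c) ⟨0, by simp, by simp⟩ ?_ ?_ ?_
  · rintro s t hst ⟨c, hc, h⟩
    exact ⟨c, hc, fun x hx => h x (hst hx)⟩
  · rintro s t ⟨c, hc, h⟩ ⟨c', hc', h'⟩
    refine ⟨max c c', by simp [hc, hc'], ?_⟩
    rintro x (hx | hx)
    · exact (h x hx).trans (le_max_left _ _)
    · exact (h' x hx).trans (le_max_right _ _)
  · intro x hx
    obtain ⟨c, hc, hx'⟩ := h x hx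
    refine ⟨{s | s ∈ S → m s ≤ c} ∩ S, ?_, c, hc, fun t ht => ht.1 ht.2⟩
    exact Filter.inter_mem (mem_nhdsWithin_of_mem_nhds hx') self_mem_nhdsWithin

/-- A lower semicontinuous function on an interval whose finite values propagate at a bounded
rate, and whose infinity set is an `F_σ`, is bounded as soon as it is finite at `0`. -/
theorem bounded_of_baire {m : ℝ → ℝ≥0∞} {T δ : ℝ} (hT : 0 ≤ T) (hδ : 0 < δ)
    (hlsc : ∀ c, IsClosed {t | t ∈ Icc 0 T ∧ m t ≤ c})
    (G : ℕ → Set ℝ) (hG : ∀ k, IsClosed (G k))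
    (hGm : ∀ t ∈ Icc 0 T, m t = ∞ ↔ ∃ k, t ∈ G k)
    (hcomp : ∀ a ∈ Icc 0 T, ∀ b ∈ Icc 0 T, |a - b| ≤ δ → (∃ c ≠ ∞, ∀ t ∈ uIcc a b, m t ≤ c) →
      ∀ r ∈ uIcc a b, ∀ t ∈ uIcc a b, m t ≤ 2 * m r)
    (hfroz : ∀ a ∈ Icc 0 T, ∀ b ∈ Icc 0 T, a ≠ b → (∀ t ∈ uIcc a b, t ≠ a → m t = ∞) →
      m a = ∞)
    (h0 : m 0 ≠ ∞) : ∃ c ≠ ∞, ∀ t ∈ Icc 0 T, m t ≤ c := by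
  set S : Set ℝ := Icc 0 T with hS
  set u : Set ℝ := {x | ∃ c ≠ ∞, ∀ᶠ s in nhds x, s ∈ S → m s ≤ c} with hu
  set v : Set ℝ := {x | ∀ᶠ s in nhds x, s ∈ S → m s = ∞} with hv
  have uopen : IsOpen u := by
    have : u = ⋃ c : {c : ℝ≥0∞ // c ≠ ∞}, {x | ∀ᶠ s in nhds x, s ∈ S → m s ≤ c} := by
      ext x; simp [hu]
    rw [this]
    exact isOpen_iUnion fun c => isOpen_setOfPred_eventually_nhds
  have vopen : IsOpen v := isOpen_setOfPred_eventually_nhds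
  have uv : ∀ x ∈ S, x ∈ u → x ∈ v → False := by
    rintro x hx ⟨c, hc, h1⟩ h2
    exact hc (top_le_iff.1 ((h2.self_of_nhds hx) ▸ h1.self_of_nhds hx))
  have dich : ∀ C : Set ℝ, IsPreconnected C → C ⊆ S → C ⊆ u ∪ v → C ⊆ u ∨ C ⊆ v := by
    intro C hC hCS hCuv
    by_contra hcon
    rw [not_or, not_subset, not_subset] at hcon
    obtain ⟨⟨x, hx, hxu⟩, y, hy, hyv⟩ := hcon
    obtain ⟨z, hz, hzu, hzv⟩ := hC u v uopen vopen hCuv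
      ⟨y, hy, (hCuv hy).resolve_right hyv⟩ ⟨x, hx, (hCuv hx).resolve_left hxu⟩
    exact uv z (hCS hz) hzu hzv
  have hSuv : S ⊆ u ∪ v := by
    by_contra hcon
    set F : Set ℝ := S \ (u ∪ v) with hFdef
    have hFne : F.Nonempty := by
      obtain ⟨x, hx, hx'⟩ := not_subset.1 hcon
      exact ⟨x, hx, hx'⟩
    have hFcl : IsClosed F := isClosed_Icc.sdiff (uopen.union vopen)
    obtain ⟨i, τ, hτ, η, hη, hloc⟩ := exists_open_of_closed_cover hFcl hFne
      (A := Sum.elim (fun n : ℕ => {t | t ∈ S ∧ m t ≤ n}) G)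
      (by rintro (n | n); exacts [hlsc _, hG n])
      (by
        intro x hx
        by_cases hxm : m x = ∞
        · obtain ⟨k, hk⟩ := (hGm x hx.1).1 hxm
          exact mem_iUnion.2 ⟨Sum.inr k, hk⟩
        · obtain ⟨n, hn⟩ := ENNReal.exists_nat_gt hxm
          exact mem_iUnion.2 ⟨Sum.inl n, hx.1, hn.le⟩)
    have key : ∀ t ∈ S, |t - τ| < min η δ → t ∉ F →
        ∃ b ∈ F, |b - τ| < η ∧ ((m b = ∞ ∧ m t = ∞) ∨ (m t ≠ ∞ ∧ m b ≠ ∞ ∧ m t ≤ 2 * m b)) := by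
      intro t ht htτ htF
      have hcpt : IsCompact (F ∩ uIcc τ t) := isCompact_uIcc.inter_left hFcl
      obtain ⟨b, hb, hmin⟩ := hcpt.exists_isMinOn ⟨τ, hτ, left_mem_uIcc⟩
        (f := fun x => |x - t|) (by fun_prop)
      have hbt : b ≠ t := by rintro rfl; exact htF hb.1
      have hsub : uIcc b t ⊆ uIcc τ t := uIcc_subset_uIcc_right hb.2
      have hsubS : uIcc b t ⊆ S := by
        have : OrdConnected S := ordConnected_Icc
        exact this.uIcc_subset hb.1.1 ht
      have hτb : |b - τ| ≤ |t - τ| := by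
        have := abs_sub_left_of_mem_uIcc hb.2
        simpa using this
      have hbt' : |b - t| ≤ |τ - t| := by
        have := hmin (show τ ∈ F ∩ uIcc τ t from ⟨hτ, left_mem_uIcc⟩)
        simpa using this
      set C : Set ℝ := {x | x ∈ uIcc b t ∧ x ≠ b} with hC
      have hCF : ∀ x ∈ C, x ∉ F := by
        rintro x ⟨hx, hxb⟩ hxF
        have h1 : |b - t| ≤ |x - t| := hmin ⟨hxF, hsub hx⟩
        rcases le_total b t with h | h
        · rw [uIcc_of_le h] at hx
          rw [abs_of_nonpos (by linarith), abs_of_nonpos (by linarith [hx.2])] at h1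
          exact hxb (le_antisymm (by linarith) hx.1)
        · rw [uIcc_of_ge h] at hx
          rw [abs_of_nonneg (by linarith), abs_of_nonneg (by linarith [hx.1])] at h1
          exact hxb (le_antisymm hx.2 (by linarith))
      have hCconn : IsPreconnected C := by
        rcases le_total b t with h | h
        · have : C = Ioc b t := by
            ext x; simp only [hC, uIcc_of_le h, mem_ofPred_eq, mem_Icc, mem_Ioc]
            constructor
            · rintro ⟨⟨h1, h2⟩, h3⟩; exact ⟨lt_of_le_of_ne h1 (Ne.symm h3), h2⟩
            · rintro ⟨h1, h2⟩; exact ⟨⟨h1.le, h2⟩, h1.ne'⟩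
          rw [this]; exact isPreconnected_Ioc
        · have : C = Ico t b := by
            ext x; simp only [hC, uIcc_of_ge h, mem_ofPred_eq, mem_Icc, mem_Ico]
            constructor
            · rintro ⟨⟨h1, h2⟩, h3⟩; exact ⟨h1, lt_of_le_of_ne h2 h3⟩
            · rintro ⟨h1, h2⟩; exact ⟨⟨h1, h2.le⟩, h2.ne⟩
          rw [this]; exact isPreconnected_Ico
      have htC : t ∈ C := ⟨right_mem_uIcc, hbt.symm⟩
      have hCuv : C ⊆ u ∪ v := fun x hx => by
        by_contra hn; exact hCF x hx ⟨hsubS hx.1, hn⟩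
      refine ⟨b, hb.1, hτb.trans_lt (htτ.trans_le (min_le_left _ _)), ?_⟩
      have hle : |b - t| ≤ δ := by
        rw [abs_sub_comm τ t] at hbt'
        exact hbt'.trans (htτ.le.trans (min_le_right _ _))
      rcases dich C hCconn (fun x hx => hsubS hx.1) hCuv with hCu | hCv
      · right
        have hbdd : ∀ r ∈ C, m r ≤ 2 * m t := by
          intro r hr
          have hsub' : uIcc r t ⊆ C := by
            intro x hx
            refine ⟨uIcc_subset_uIcc_right hr.1 hx, ?_⟩
            rintro rfl
            obtain ⟨hr1, hr2⟩ := hr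
            rcases le_total x t with h | h
            · rw [uIcc_of_le h] at hr1
              rw [uIcc_of_le hr1.2] at hx
              exact hr2 (le_antisymm hx.1 hr1.1)
            · rw [uIcc_of_ge h] at hr1
              rw [uIcc_of_ge hr1.1] at hx
              exact hr2 (le_antisymm hr1.2 hx.2)
          have hrt : |r - t| ≤ δ := by
            rw [abs_sub_comm r t]
            refine (abs_sub_right_of_mem_uIcc hr.1).trans ?_
            rwa [abs_sub_comm]
          refine hcomp r (hsubS hr.1) t ht hrt ?_ t right_mem_uIcc r left_mem_uIcc
          refine exists_bound_of_locally_bounded isCompact_uIcc fun x hx => ?_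
          obtain ⟨c, hc, hx'⟩ := hCu (hsub' hx)
          exact ⟨c, hc, hx'.mono fun s hs hs' => hs (hsubS (hsub' hs').1)⟩
        have htfin : m t ≠ ∞ := by
          obtain ⟨c, hc, h⟩ := hCu htC
          exact ne_top_of_le_ne_top hc (h.self_of_nhds ht)
        have hbcl : b ∈ closure C := by
          rcases lt_or_gt_of_ne hbt with h | h
          · have : Ioo b t ⊆ C := fun x hx =>
              ⟨by rw [uIcc_of_le h.le]; exact Ioo_subset_Icc_self hx, hx.1.ne'⟩
            exact closure_mono this (by rw [closure_Ioo h.ne]; exact left_mem_Icc.2 h.le)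
          · have : Ioo t b ⊆ C := fun x hx =>
              ⟨by rw [uIcc_of_ge h.le]; exact Ioo_subset_Icc_self hx, hx.2.ne⟩
            exact closure_mono this (by rw [closure_Ioo h.ne]; exact right_mem_Icc.2 h.le)
        have hmb : m b ≤ 2 * m t :=
          (closure_minimal (show C ⊆ {s | s ∈ S ∧ m s ≤ 2 * m t} from
            fun r hr => ⟨hsubS hr.1, hbdd r hr⟩) (hlsc (2 * m t)) hbcl).2
        have h2 : 2 * m t ≠ ∞ := ENNReal.mul_ne_top (by simp) htfin
        refine ⟨htfin, ne_top_of_le_ne_top h2 hmb, ?_⟩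
        refine hcomp b hb.1.1 t ht hle ⟨2 * m t, h2, fun x hx => ?_⟩ b left_mem_uIcc t
          right_mem_uIcc
        by_cases hxb : x = b
        · rw [hxb]; exact hmb
        · exact hbdd x ⟨hx, hxb⟩
      · left
        refine ⟨hfroz b hb.1.1 t ht hbt fun x hx hxb => ?_, ?_⟩
        · exact (hCv ⟨hx, hxb⟩).self_of_nhds (hsubS hx)
        · exact (hCv htC).self_of_nhds ht
    have hnear : ∀ᶠ s in nhds τ, |s - τ| < min η δ := by
      have := Metric.ball_mem_nhds τ (lt_min hη hδ)
      filter_upwards [this] with s hs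
      simpa [Real.dist_eq] using hs
    rcases i with n | k
    · refine hτ.2 (Or.inl ⟨2 * n, ENNReal.mul_ne_top (by simp) (by simp), ?_⟩)
      filter_upwards [hnear] with s hs hsS
      by_cases hsF : s ∈ F
      · refine (hloc s hsF (hs.trans_le (min_le_left _ _))).2.trans ?_
        rw [two_mul]; exact le_self_add
      · obtain ⟨b, hbF, hbτ, h | h⟩ := key s hsS hs hsF
        · have := (hloc b hbF hbτ).2
          rw [h.1] at this
          simp at this
        · exact h.2.2.trans (by gcongr; exact (hloc b hbF hbτ).2)
    · refine hτ.2 (Or.inr ?_)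
      filter_upwards [hnear] with s hs hsS
      by_cases hsF : s ∈ F
      · exact (hGm s hsS).2 ⟨k, hloc s hsF (hs.trans_le (min_le_left _ _))⟩
      · obtain ⟨b, hbF, hbτ, h | h⟩ := key s hsS hs hsF
        · exact h.2
        · exact absurd ((hGm b hbF.1).2 ⟨k, hloc b hbF hbτ⟩) h.2.1
  refine exists_bound_of_locally_bounded isCompact_Icc fun x hx => ?_
  rcases dich S isPreconnected_Icc Subset.rfl hSuv with h | h
  · exact h hx
  · exact absurd ((h (left_mem_Icc.2 hT)).self_of_nhds (left_mem_Icc.2 hT)) h0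

section Field

variable {E : Type*} [NormedAddCommGroup E] [InnerProductSpace ℝ E] [FiniteDimensional ℝ E]
  [MeasureSpace E] [BorelSpace E]

/-- The spatial mass of a phase-space measure in a closed ball. -/
def massBall (μ : Measure (E × E)) (x : E) (r : ℝ) : ℝ := μ.real (closedBall x r ×ˢ univ)

/-- The interaction field of `ν` with topological weights computed from `μ`. -/
def topField (k : ℝ → ℝ) (μ ν : Measure (E × E)) (x v : E) : E :=
  ∫ p, k (massBall μ x (dist x p.1)) • (p.2 - v) ∂ν

/-- A Lipschitz communication kernel with values between two positive constants. -/
structure IsCommKernel (k : ℝ → ℝ) (K₁ K₀ : ℝ) (L : NNReal) : Prop where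
  pos : 0 < K₁
  lower : ∀ z, K₁ ≤ k z
  upper : ∀ z, k z ≤ K₀
  lip : LipschitzWith L k

theorem IsCommKernel.nonneg {k : ℝ → ℝ} {K₁ K₀ : ℝ} {L : NNReal} (hk : IsCommKernel k K₁ K₀ L)
    (z : ℝ) : 0 ≤ k z := hk.pos.le.trans (hk.lower z)

theorem IsCommKernel.upper_pos {k : ℝ → ℝ} {K₁ K₀ : ℝ} {L : NNReal}
    (hk : IsCommKernel k K₁ K₀ L) : 0 < K₀ := hk.pos.trans_le ((hk.lower 0).trans (hk.upper 0))

theorem measurable_massBall_uncurry (μ : Measure (E × E)) [IsProbabilityMeasure μ] :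
    Measurable fun q : E × ℝ => massBall μ q.1 q.2 := by
  have hs : MeasurableSet {z : (E × ℝ) × (E × E) | dist z.2.1 z.1.1 ≤ z.1.2} :=
    (isClosed_le (by fun_prop) (by fun_prop)).measurableSet
  have := (measurable_measure_prodMk_left (ν := μ) hs).ennreal_toReal
  refine (congrArg Measurable (funext fun q => ?_)).mp this
  rw [massBall, measureReal_def]
  congr 2
  ext p; simp

theorem measurable_weight {k : ℝ → ℝ} {K₁ K₀ : ℝ} {L : NNReal} (hk : IsCommKernel k K₁ K₀ L)
    (μ : Measure (E × E)) [IsProbabilityMeasure μ] :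
    Measurable fun z : E × (E × E) => k (massBall μ z.1 (dist z.1 z.2.1)) := by
  refine hk.lip.continuous.measurable.comp ((measurable_massBall_uncurry μ).comp
    (g := fun q : E × ℝ => massBall μ q.1 q.2) (f := fun z : E × (E × E) => (z.1, dist z.1 z.2.1)) ?_)
  fun_prop

variable {k : ℝ → ℝ} {K₁ K₀ : ℝ} {L : NNReal}

theorem IsCommKernel.abs_le (hk : IsCommKernel k K₁ K₀ L) (z : ℝ) : |k z| ≤ K₀ := by
  rw [abs_of_nonneg (hk.nonneg z)]; exact hk.upper z

theorem integrable_weight (hk : IsCommKernel k K₁ K₀ L)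
    (μ ν : Measure (E × E)) [IsProbabilityMeasure μ] [IsProbabilityMeasure ν] (x : E) :
    Integrable (fun p : E × E => k (massBall μ x (dist x p.1))) ν :=
  Integrable.of_bound
    ((measurable_weight hk μ).comp (measurable_const.prodMk measurable_id)).aestronglyMeasurable
    K₀ (ae_of_all _ fun p => by simpa using hk.abs_le _)

theorem integrable_snd_iff (ν : Measure (E × E)) :
    Integrable (fun p : E × E => p.2) ν ↔ (∫⁻ p, ‖p.2‖ₑ ∂ν) ≠ ∞ := by
  rw [← lt_top_iff_ne_top]
  exact ⟨fun h => h.2, fun h => ⟨measurable_snd.aestronglyMeasurable, h⟩⟩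

theorem integrable_field_iff (hk : IsCommKernel k K₁ K₀ L)
    (μ ν : Measure (E × E)) [IsProbabilityMeasure μ] [IsProbabilityMeasure ν] (x v : E) :
    Integrable (fun p : E × E => k (massBall μ x (dist x p.1)) • (p.2 - v)) ν ↔
      Integrable (fun p : E × E => p.2) ν := by
  have hm : Measurable fun p : E × E => k (massBall μ x (dist x p.1)) :=
    (measurable_weight hk μ).comp (measurable_const.prodMk measurable_id)
  constructor
  · intro h
    have h1 : Integrable (fun p : E × E => p.2 - v) ν := by
      refine (h.norm.const_mul K₁⁻¹).mono' (by fun_prop) (ae_of_all _ fun p => ?_)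
      rw [norm_smul, Real.norm_of_nonneg (hk.nonneg _), ← mul_assoc]
      refine le_mul_of_one_le_left (norm_nonneg _) ?_
      rw [inv_mul_eq_div, one_le_div hk.pos]; exact hk.lower _
    exact (h1.add (integrable_const v)).congr (ae_of_all _ fun p => sub_add_cancel _ _)
  · intro h
    exact (h.sub (integrable_const v)).bdd_smul K₀ hm.aestronglyMeasurable
      (ae_of_all _ fun p => hk.abs_le _)

theorem topField_eq_zero (hk : IsCommKernel k K₁ K₀ L)
    (μ ν : Measure (E × E)) [IsProbabilityMeasure μ] [IsProbabilityMeasure ν] (x v : E)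
    (h : (∫⁻ p, ‖p.2‖ₑ ∂ν) = ∞) : topField k μ ν x v = 0 := by
  refine integral_undef ?_
  rw [integrable_field_iff hk, integrable_snd_iff]
  simpa using h

theorem norm_topField_le (hk : IsCommKernel k K₁ K₀ L)
    (μ ν : Measure (E × E)) [IsProbabilityMeasure μ] [IsProbabilityMeasure ν] (x v : E) :
    ‖topField k μ ν x v‖ ≤ K₀ * ((∫⁻ p, ‖p.2‖ₑ ∂ν).toReal + ‖v‖) := by
  have hK := hk.upper_pos
  by_cases h : (∫⁻ p, ‖p.2‖ₑ ∂ν) = ∞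
  · rw [topField_eq_zero hk μ ν x v h, norm_zero]; positivity
  have hi := (integrable_snd_iff ν).2 h
  have : (∫⁻ p, ‖p.2‖ₑ ∂ν).toReal + ‖v‖ = ∫ p : E × E, (‖p.2‖ + ‖v‖) ∂ν := by
    rw [integral_add hi.norm (integrable_const _),
      integral_norm_eq_lintegral_enorm measurable_snd.aestronglyMeasurable]
    simp
  rw [this, ← integral_const_mul]
  refine norm_integral_le_of_norm_le ((hi.norm.add (integrable_const _)).const_mul _)
    (ae_of_all _ fun p => ?_)
  rw [norm_smul]
  gcongr
  · exact hk.abs_le _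
  · exact norm_sub_le _ _

theorem topField_sub (hk : IsCommKernel k K₁ K₀ L)
    (μ ν : Measure (E × E)) [IsProbabilityMeasure μ] [IsProbabilityMeasure ν] (x v v' : E)
    (h : (∫⁻ p, ‖p.2‖ₑ ∂ν) ≠ ∞) :
    topField k μ ν x v - topField k μ ν x v' =
      -((∫ p, k (massBall μ x (dist x p.1)) ∂ν) • (v - v')) := by
  have hi := (integrable_snd_iff ν).2 h
  rw [topField, topField, ← integral_sub ((integrable_field_iff hk μ ν x v).2 hi)
    ((integrable_field_iff hk μ ν x v').2 hi), ← integral_smul_const, ← integral_neg]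
  congr 1; ext p; rw [← smul_sub, ← smul_neg]; congr 1; abel

theorem weight_integral_ge (hk : IsCommKernel k K₁ K₀ L)
    (μ ν : Measure (E × E)) [IsProbabilityMeasure μ] [IsProbabilityMeasure ν] (x : E) :
    K₁ ≤ ∫ p, k (massBall μ x (dist x p.1)) ∂ν := by
  have := integral_mono (μ := ν) (integrable_const K₁) (integrable_weight hk μ ν x)
    (fun p => hk.lower _)
  simpa using this

theorem weight_integral_le (hk : IsCommKernel k K₁ K₀ L)
    (μ ν : Measure (E × E)) [IsProbabilityMeasure μ] [IsProbabilityMeasure ν] (x : E) :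
    ∫ p, k (massBall μ x (dist x p.1)) ∂ν ≤ K₀ := by
  have := integral_mono (μ := ν) (integrable_weight hk μ ν x) (integrable_const K₀)
    (fun p => hk.upper _)
  simpa using this

theorem measurable_topField (hk : IsCommKernel k K₁ K₀ L)
    (μ ν : Measure (E × E)) [IsProbabilityMeasure μ] [IsProbabilityMeasure ν] :
    Measurable fun q : E × E => topField k μ ν q.1 q.2 := by
  have : StronglyMeasurable fun z : (E × E) × (E × E) =>
      k (massBall μ z.1.1 (dist z.1.1 z.2.1)) • (z.2.2 - z.1.2) := by
    refine Measurable.stronglyMeasurable ?_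
    have h1 := (measurable_weight hk μ).comp
      (f := fun z : (E × E) × (E × E) => (z.1.1, z.2)) (by fun_prop)
    exact h1.smul (by fun_prop)
  exact this.integral_prod_right.measurable

/-- The phase-space set on which the field is small has small volume over bounded positions. -/
theorem volume_small_field [(volume : Measure E).IsAddHaarMeasure]
    (hk : IsCommKernel k K₁ K₀ L)
    (μ ν : Measure (E × E)) [IsProbabilityMeasure μ] [IsProbabilityMeasure ν]
    (h : (∫⁻ p, ‖p.2‖ₑ ∂ν) ≠ ∞) (R ε : ℝ) :
    (volume : Measure (E × E)) {p | ‖p.1‖ ≤ R ∧ ‖topField k μ ν p.1 p.2‖ ≤ ε} ≤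
      volume (closedBall (0 : E) (2 * ε / K₁)) * volume (closedBall (0 : E) R) := by
  have hmeas : MeasurableSet {p : E × E | ‖p.1‖ ≤ R ∧ ‖topField k μ ν p.1 p.2‖ ≤ ε} :=
    (measurableSet_le (f := fun p : E × E => ‖p.1‖) (by fun_prop) measurable_const).inter
      (measurableSet_le (measurable_topField hk μ ν).norm measurable_const)
  rw [Measure.volume_eq_prod, Measure.prod_apply hmeas, ← lintegral_indicator_const
    isClosed_closedBall.measurableSet]
  refine lintegral_mono fun x => ?_
  by_cases hx : ‖x‖ ≤ R
  · rw [indicator_of_mem (by simpa using hx)]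
    rcases (Prod.mk x ⁻¹' {p : E × E | ‖p.1‖ ≤ R ∧ ‖topField k μ ν p.1 p.2‖ ≤ ε}).eq_empty_or_nonempty
      with he | ⟨v₀, hv₀⟩
    · rw [he]; simp
    rw [← Measure.addHaar_closedBall_center volume v₀]
    refine measure_mono fun v hv => ?_
    rw [mem_closedBall, dist_eq_norm, le_div_iff₀ hk.pos]
    have h1 : ‖topField k μ ν x v - topField k μ ν x v₀‖ ≤ 2 * ε :=
      (norm_sub_le _ _).trans (by linarith [hv.2, hv₀.2])
    rw [topField_sub hk μ ν x v v₀ h, norm_neg, norm_smul, Real.norm_of_nonneg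
      (hk.pos.le.trans (weight_integral_ge hk μ ν x))] at h1
    rw [mul_comm]
    exact (mul_le_mul_of_nonneg_right (weight_integral_ge hk μ ν x) (norm_nonneg _)).trans h1
  · have : Prod.mk x ⁻¹' {p : E × E | ‖p.1‖ ≤ R ∧ ‖topField k μ ν p.1 p.2‖ ≤ ε} = ∅ := by
      ext v; simp [hx]
    rw [this]; simp

end Field

theorem measure_le_of_eventually_mem {α : Type*} [MeasurableSpace α] {μ : Measure α}
    {A : ℕ → Set α} {U : Set α} {c : ℝ≥0∞} (h : ∀ p ∈ U, ∀ᶠ j in Filter.atTop, p ∈ A j)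
    (hA : ∀ j, μ (A j) ≤ c) : μ U ≤ c := by
  have hsub : U ⊆ ⋃ n, ⋂ j ≥ n, A j := fun p hp => by
    obtain ⟨n, hn⟩ := Filter.eventually_atTop.1 (h p hp)
    exact mem_iUnion.2 ⟨n, mem_iInter₂.2 hn⟩
  refine (measure_mono hsub).trans ?_
  have hmono : Monotone fun n => ⋂ j ≥ n, A j := fun n n' hn =>
    biInter_subset_biInter_left fun j (hj : n' ≤ j) => hn.trans hj
  rw [hmono.measure_iUnion]
  exact iSup_le fun n => (measure_mono (biInter_subset_of_mem (le_refl n))).trans (hA n)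

theorem nullMeasurableSet_exists_mem {α : Type*} [MeasurableSpace α] {μ : Measure α}
    {S : Set ℝ} {A : ℝ → Set α} (hA : ∀ s ∈ S, NullMeasurableSet (A s) μ)
    (hopen : ∀ p, IsOpen {s : S | p ∈ A s}) : NullMeasurableSet {p | ∃ s ∈ S, p ∈ A s} μ := by
  obtain ⟨D, hDc, hDd⟩ := TopologicalSpace.exists_countable_dense S
  have : {p | ∃ s ∈ S, p ∈ A s} = ⋃ s ∈ D, A s := by
    ext p
    simp only [mem_ofPred_eq, mem_iUnion]
    constructor
    · rintro ⟨s, hs, hp⟩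
      obtain ⟨y, hy, hyD⟩ := hDd.inter_open_nonempty _ (hopen p) ⟨⟨s, hs⟩, hp⟩
      exact ⟨y, hyD, hy⟩
    · rintro ⟨s, _, hp⟩
      exact ⟨s, s.2, hp⟩
  rw [this]
  exact NullMeasurableSet.biUnion hDc fun s _ => hA s s.2

/-- A family of measures transported by the flow of its own topological interaction field. -/
structure IsMeasureFlow {E : Type*} [NormedAddCommGroup E] [InnerProductSpace ℝ E]
    [MeasureSpace E] (k : ℝ → ℝ) (T : ℝ) (μ₀ : Measure (E × E)) (F : ℝ → Measure (E × E))
    (Z : ℝ → E × E → E × E) : Prop where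
  prob : IsProbabilityMeasure μ₀
  aemeasurable : ∀ t ∈ Icc 0 T, AEMeasurable (Z t) μ₀
  map_eq : ∀ t ∈ Icc 0 T, μ₀.map (Z t) = F t
  zero : ∀ p, Z 0 p = p
  pos : ∀ p, ∀ t ∈ Icc 0 T, HasDerivWithinAt (fun τ => (Z τ p).1) (Z t p).2 (Icc 0 T) t
  vel : ∀ p, ∀ t ∈ Icc 0 T,
    HasDerivWithinAt (fun τ => (Z τ p).2) (topField k (F t) (F t) (Z t p).1 (Z t p).2) (Icc 0 T) t

namespace IsMeasureFlow

variable {E : Type*} [NormedAddCommGroup E] [InnerProductSpace ℝ E] [FiniteDimensional ℝ E]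
  [MeasureSpace E] [BorelSpace E] {k : ℝ → ℝ} {K₁ K₀ T : ℝ} {L : NNReal}
  {μ₀ : Measure (E × E)} {F : ℝ → Measure (E × E)} {Z : ℝ → E × E → E × E}

theorem isProbabilityMeasure (h : IsMeasureFlow k T μ₀ F Z) {t : ℝ} (ht : t ∈ Icc 0 T) :
    IsProbabilityMeasure (F t) := by
  have := h.prob
  rw [← h.map_eq t ht]
  exact Measure.isProbabilityMeasure_map (h.aemeasurable t ht)

theorem lintegral_snd (h : IsMeasureFlow k T μ₀ F Z) {t : ℝ} (ht : t ∈ Icc 0 T) :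
    ∫⁻ p, ‖p.2‖ₑ ∂(F t) = ∫⁻ p, ‖(Z t p).2‖ₑ ∂μ₀ := by
  rw [← h.map_eq t ht, lintegral_map' (by fun_prop) (h.aemeasurable t ht)]

theorem continuousOn_pos (h : IsMeasureFlow k T μ₀ F Z) (p : E × E) :
    ContinuousOn (fun τ => (Z τ p).1) (Icc 0 T) := fun t ht => (h.pos p t ht).continuousWithinAt

theorem continuousOn_vel (h : IsMeasureFlow k T μ₀ F Z) (p : E × E) :
    ContinuousOn (fun τ => (Z τ p).2) (Icc 0 T) := fun t ht => (h.vel p t ht).continuousWithinAt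

theorem isClosed_moment_le (h : IsMeasureFlow k T μ₀ F Z) (c : ℝ≥0∞) :
    IsClosed {t | t ∈ Icc 0 T ∧ ∫⁻ p, ‖(Z t p).2‖ₑ ∂μ₀ ≤ c} := by
  refine IsSeqClosed.isClosed fun u t hu hut => ?_
  have ht : t ∈ Icc 0 T := isClosed_Icc.mem_of_tendsto hut (.of_forall fun n => (hu n).1)
  refine ⟨ht, ?_⟩
  have hlim : ∀ p, Filter.Tendsto (fun n => ‖(Z (u n) p).2‖ₑ) Filter.atTop
      (nhds ‖(Z t p).2‖ₑ) := fun p =>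
    ((h.continuousOn_vel p t ht).tendsto.comp (tendsto_nhdsWithin_iff.2
      ⟨hut, .of_forall fun n => (hu n).1⟩)).enorm
  calc ∫⁻ p, ‖(Z t p).2‖ₑ ∂μ₀
      = ∫⁻ p, Filter.liminf (fun n => ‖(Z (u n) p).2‖ₑ) Filter.atTop ∂μ₀ := by
        simp_rw [(hlim _).liminf_eq]
    _ ≤ Filter.liminf (fun n => ∫⁻ p, ‖(Z (u n) p).2‖ₑ ∂μ₀) Filter.atTop :=
        lintegral_liminf_le' fun n => (h.aemeasurable _ (hu n).1).snd.enorm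
    _ ≤ c := Filter.liminf_le_of_le (by isBoundedDefault) fun b hb => by
        obtain ⟨n, hn⟩ := hb.exists
        exact hn.trans (hu n).2

theorem vel_sub_le (h : IsMeasureFlow k T μ₀ F Z) (hk : IsCommKernel k K₁ K₀ L)
    {a b : ℝ} (ha : a ∈ Icc 0 T) (hb : b ∈ Icc 0 T) {n S : ℝ} (p : E × E)
    (hn : ∀ t ∈ uIcc a b, (∫⁻ p, ‖(Z t p).2‖ₑ ∂μ₀).toReal ≤ n)
    (hS : ∀ t ∈ uIcc a b, ‖(Z t p).2‖ ≤ S) {s r : ℝ} (hs : s ∈ uIcc a b) (hr : r ∈ uIcc a b) :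
    ‖(Z s p).2 - (Z r p).2‖ ≤ K₀ * (n + S) * |s - r| := by
  have hsub : uIcc a b ⊆ Icc 0 T := (ordConnected_Icc).uIcc_subset ha hb
  refine (convex_uIcc a b).norm_image_sub_le_of_norm_hasDerivWithin_le
    (f := fun τ => (Z τ p).2) (fun t ht => (h.vel p t (hsub ht)).mono hsub) (fun t ht => ?_) hr hs
  have := h.isProbabilityMeasure (hsub ht)
  refine (norm_topField_le hk _ _ _ _).trans ?_
  rw [h.lintegral_snd (hsub ht)]
  have := hk.upper_pos
  gcongr
  exacts [hn t ht, hS t ht]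

theorem moment_le_two_mul (h : IsMeasureFlow k T μ₀ F Z) (hk : IsCommKernel k K₁ K₀ L)
    {a b : ℝ} (ha : a ∈ Icc 0 T) (hb : b ∈ Icc 0 T) (hab : K₀ * |a - b| ≤ 1 / 4)
    (hbdd : ∃ c ≠ ∞, ∀ t ∈ uIcc a b, ∫⁻ p, ‖(Z t p).2‖ₑ ∂μ₀ ≤ c) {r t : ℝ}
    (hr : r ∈ uIcc a b) (ht : t ∈ uIcc a b) :
    ∫⁻ p, ‖(Z t p).2‖ₑ ∂μ₀ ≤ 2 * ∫⁻ p, ‖(Z r p).2‖ₑ ∂μ₀ := by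
  have hsub : uIcc a b ⊆ Icc 0 T := (ordConnected_Icc).uIcc_subset ha hb
  have := h.prob
  set m : ℝ → ℝ≥0∞ := fun t => ∫⁻ p, ‖(Z t p).2‖ₑ ∂μ₀ with hm
  obtain ⟨c, hc, hmc⟩ := hbdd
  set N : ℝ≥0∞ := ⨆ t ∈ uIcc a b, m t with hN
  have hNc : N ≤ c := iSup₂_le hmc
  have hNtop : N ≠ ∞ := ne_top_of_le_ne_top hc hNc
  have hmN : ∀ t ∈ uIcc a b, m t ≤ N := fun t ht => le_iSup₂ (f := fun t _ => m t) t ht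
  have hpt : ∀ p, ∀ t ∈ uIcc a b, ‖(Z t p).2‖ ≤ 4 / 3 * ‖(Z r p).2‖ + N.toReal / 3 := by
    intro p
    obtain ⟨s, hs, hmax⟩ := isCompact_uIcc.exists_isMaxOn ⟨r, hr⟩
      ((h.continuousOn_vel p).mono hsub).norm
    have h1 := h.vel_sub_le hk ha hb p (n := N.toReal) (S := ‖(Z s p).2‖)
      (fun t ht => ENNReal.toReal_mono hNtop (hmN t ht)) (fun t ht => hmax ht) hs hr
    have h2 : |s - r| ≤ |a - b| := by
      rw [abs_sub_comm a b]
      exact abs_sub_le_of_uIcc_subset_uIcc (uIcc_subset_uIcc hr hs)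
    have h3 : K₀ * (N.toReal + ‖(Z s p).2‖) * |s - r| ≤ 1 / 4 * (N.toReal + ‖(Z s p).2‖) := by
      have := hk.upper_pos
      calc _ = K₀ * |s - r| * (N.toReal + ‖(Z s p).2‖) := by ring
        _ ≤ _ := by
          gcongr
          exact (mul_le_mul_of_nonneg_left h2 this.le).trans hab
    have h4 := norm_sub_norm_le (Z s p).2 (Z r p).2
    intro t ht
    have h5 : ‖(Z t p).2‖ ≤ ‖(Z s p).2‖ := hmax ht
    linarith
  have hint : ∀ t ∈ uIcc a b, m t ≤ ENNReal.ofReal (4 / 3) * m r + ENNReal.ofReal (1 / 3) * N := by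
    intro t ht
    calc m t ≤ ∫⁻ p, (ENNReal.ofReal (4 / 3) * ‖(Z r p).2‖ₑ + ENNReal.ofReal (1 / 3) * N) ∂μ₀ := by
          refine lintegral_mono fun p => ?_
          rw [← ofReal_norm, ← ofReal_norm, ← ENNReal.ofReal_toReal hNtop,
            ← ENNReal.ofReal_mul (by norm_num), ← ENNReal.ofReal_mul (by norm_num),
            ← ENNReal.ofReal_add (by positivity) (by positivity)]
          refine ENNReal.ofReal_le_ofReal ((hpt p t ht).trans_eq (by ring))
      _ = _ := by
          rw [lintegral_add_right _ measurable_const, lintegral_const_mul' _ _ (by simp)]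
          simp [hm]
  have hNle : N ≤ ENNReal.ofReal (4 / 3) * m r + ENNReal.ofReal (1 / 3) * N := iSup₂_le hint
  have hmr : m r ≠ ∞ := ne_top_of_le_ne_top hNtop (hmN r hr)
  refine (hmN t ht).trans ?_
  rw [← ENNReal.ofReal_toReal hNtop, ← ENNReal.ofReal_toReal hmr,
    ← ENNReal.ofReal_mul (by norm_num), ← ENNReal.ofReal_mul (by norm_num),
    ← ENNReal.ofReal_add (by positivity) (by positivity),
    ENNReal.ofReal_le_ofReal_iff (by positivity)] at hNle
  change N ≤ 2 * m r
  rw [← ENNReal.ofReal_toReal hNtop, ← ENNReal.ofReal_toReal hmr,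
    show (2 : ℝ≥0∞) = ENNReal.ofReal 2 by simp, ← ENNReal.ofReal_mul (by norm_num),
    ENNReal.ofReal_le_ofReal_iff (by positivity)]
  linarith

theorem moment_eq_top_of_adjacent (h : IsMeasureFlow k T μ₀ F Z) (hk : IsCommKernel k K₁ K₀ L)
    {a b : ℝ} (ha : a ∈ Icc 0 T) (hb : b ∈ Icc 0 T) (hab : a ≠ b)
    (htop : ∀ t ∈ uIcc a b, t ≠ a → ∫⁻ p, ‖(Z t p).2‖ₑ ∂μ₀ = ∞) :
    ∫⁻ p, ‖(Z a p).2‖ₑ ∂μ₀ = ∞ := by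
  have hsub : uIcc a b ⊆ Icc 0 T := (ordConnected_Icc).uIcc_subset ha hb
  rw [← htop b right_mem_uIcc hab.symm]
  have hconst : ∀ p, ∀ s ∈ uIcc a b, s ≠ a → (Z s p).2 = (Z b p).2 := by
    intro p s hs hsa
    have hsub' : uIcc s b ⊆ uIcc a b := uIcc_subset_uIcc_right hs
    have hne : ∀ t ∈ uIcc s b, t ≠ a := by
      rintro t ht rfl
      rcases le_total t b with h | h
      · rw [uIcc_of_le h] at hs
        rw [uIcc_of_le hs.2] at ht
        exact hsa (le_antisymm ht.1 hs.1)
      · rw [uIcc_of_ge h] at hs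
        rw [uIcc_of_ge hs.1] at ht
        exact hsa (le_antisymm hs.2 ht.2)
    have := (convex_uIcc s b).norm_image_sub_le_of_norm_hasDerivWithin_le
      (f := fun τ => (Z τ p).2) (C := 0)
      (fun t ht => (h.vel p t (hsub (hsub' ht))).mono (hsub'.trans hsub)) (fun t ht => ?_)
      right_mem_uIcc left_mem_uIcc
    · rw [zero_mul, norm_le_zero_iff, sub_eq_zero] at this
      exact this
    · have hp := h.isProbabilityMeasure (hsub (hsub' ht))
      rw [topField_eq_zero hk _ _ _ _ ?_, norm_zero]
      rw [h.lintegral_snd (hsub (hsub' ht))]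
      exact htop t (hsub' ht) (hne t ht)
  refine lintegral_congr fun p => ?_
  have hcl : a ∈ closure (uIcc a b \ {a}) := by
    rcases lt_or_gt_of_ne hab with h | h
    · have : Ioo a b ⊆ uIcc a b \ {a} := fun x hx =>
        ⟨by rw [uIcc_of_le h.le]; exact Ioo_subset_Icc_self hx, hx.1.ne'⟩
      exact closure_mono this (by rw [closure_Ioo h.ne]; exact left_mem_Icc.2 h.le)
    · have : Ioo b a ⊆ uIcc a b \ {a} := fun x hx =>
        ⟨by rw [uIcc_of_ge h.le]; exact Ioo_subset_Icc_self hx, hx.2.ne⟩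
      exact closure_mono this (by rw [closure_Ioo h.ne]; exact right_mem_Icc.2 h.le)
  have hcw : ContinuousWithinAt (fun τ => (Z τ p).2) (uIcc a b \ {a}) a :=
    (h.continuousOn_vel p a ha).mono (sdiff_subset.trans hsub)
  have hmem := hcw.mem_closure_image hcl
  have himg : (fun τ => (Z τ p).2) '' (uIcc a b \ {a}) ⊆ {(Z b p).2} := by
    rintro _ ⟨s, hs, rfl⟩
    exact hconst p s hs.1 hs.2
  have := closure_mono himg hmem
  rw [closure_singleton] at this
  rw [show (Z a p).2 = (Z b p).2 from this]

end IsMeasureFlow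

theorem norm_le_of_hasDerivWithinAt_of_lip {G : Type*} [NormedAddCommGroup G] [NormedSpace ℝ G]
    {g : ℝ → G} {g' : G} {T t ε η : ℝ} (hT : 0 < T) (ht : t ∈ Icc 0 T) (hη : 0 < η)
    (hg : HasDerivWithinAt g g' (Icc 0 T) t)
    (hlip : ∀ s ∈ Icc 0 T, |s - t| < η → ‖g s - g t‖ ≤ ε * |s - t|) : ‖g'‖ ≤ ε := by
  rw [hasDerivWithinAt_iff_tendsto_slope] at hg
  have hne : (nhdsWithin t (Icc 0 T \ {t})).NeBot := by
    have := (uniqueDiffOn_Icc hT t ht).accPt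
    rwa [accPt_principal_iff_nhdsWithin] at this
  refine le_of_tendsto hg.norm ?_
  have h1 : ∀ᶠ s in nhdsWithin t (Icc 0 T \ {t}), |s - t| < η := by
    have : ball t η ∈ nhds t := ball_mem_nhds t hη
    filter_upwards [mem_nhdsWithin_of_mem_nhds this] with s hs
    simpa [Real.dist_eq] using hs
  filter_upwards [h1, self_mem_nhdsWithin] with s hs hsm
  have hpos : 0 < |s - t| := abs_pos.2 (sub_ne_zero.2 hsm.2)
  rw [slope_def_module, norm_smul, norm_inv, Real.norm_eq_abs, inv_mul_le_iff₀ hpos, mul_comm]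
  exact hlip s hsm.1 hs

namespace IsMeasureFlow

variable {E : Type*} [NormedAddCommGroup E] [InnerProductSpace ℝ E] [FiniteDimensional ℝ E]
  [MeasureSpace E] [BorelSpace E] {k : ℝ → ℝ} {K₁ K₀ T : ℝ} {L : NNReal}
  {μ₀ : Measure (E × E)} {F : ℝ → Measure (E × E)} {Z : ℝ → E × E → E × E}

/-- Trajectories whose velocity varies at a rate exceeding `ε` near time `t`. -/
def fastSet (T : ℝ) (Z : ℝ → E × E → E × E) (ε η t : ℝ) : Set (E × E) :=
  {p | ∃ s ∈ Icc 0 T ∩ ball t η, p ∈ {p | ε * |s - t| < ‖(Z s p).2 - (Z t p).2‖}}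

theorem nullMeasurableSet_fastSet (h : IsMeasureFlow k T μ₀ F Z) {ε η t : ℝ}
    (ht : t ∈ Icc 0 T) : NullMeasurableSet (fastSet T Z ε η t) μ₀ := by
  refine nullMeasurableSet_exists_mem (fun s hs => ?_) fun p => ?_
  · exact nullMeasurableSet_lt aemeasurable_const
      ((h.aemeasurable s hs.1).snd.sub (h.aemeasurable t ht).snd).norm
  · have hc : Continuous fun s : ↥(Icc 0 T ∩ ball t η) => (Z s p).2 :=
      ((h.continuousOn_vel p).mono inter_subset_left).domRestrict
    exact isOpen_lt (f := fun s : ↥(Icc 0 T ∩ ball t η) => ε * |(s : ℝ) - t|)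
      (g := fun s => ‖(Z s p).2 - (Z t p).2‖) (by fun_prop) (by fun_prop)

theorem isClosed_fastSet_le (h : IsMeasureFlow k T μ₀ F Z) {ε η : ℝ} (c : ℝ≥0∞) :
    IsClosed {t | t ∈ Icc 0 T ∧ μ₀ (fastSet T Z ε η t) ≤ c} := by
  refine IsSeqClosed.isClosed fun u t hu hut => ?_
  have ht : t ∈ Icc 0 T := isClosed_Icc.mem_of_tendsto hut (.of_forall fun n => (hu n).1)
  refine ⟨ht, measure_le_of_eventually_mem (A := fun j => fastSet T Z ε η (u j)) ?_
    fun j => (hu j).2⟩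
  rintro p ⟨s, ⟨hs, hst⟩, hp⟩
  have hlim : Filter.Tendsto (fun n => (Z (u n) p).2) Filter.atTop (nhds (Z t p).2) :=
    (h.continuousOn_vel p t ht).tendsto.comp (tendsto_nhdsWithin_iff.2
      ⟨hut, .of_forall fun n => (hu n).1⟩)
  have h1 : ∀ᶠ j in Filter.atTop, ε * |s - u j| < ‖(Z s p).2 - (Z (u j) p).2‖ :=
    ((tendsto_const_nhds.sub hut).abs.const_mul ε).eventually_lt
      (tendsto_const_nhds.sub hlim).norm hp
  have h2 : ∀ᶠ j in Filter.atTop, dist s (u j) < η :=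
    (tendsto_const_nhds.dist hut).eventually_lt tendsto_const_nhds hst
  filter_upwards [h1, h2] with j hj hj'
  exact ⟨s, ⟨hs, hj'⟩, hj⟩

theorem exists_fastSet_le (h : IsMeasureFlow k T μ₀ F Z) (hk : IsCommKernel k K₁ K₀ L)
    {ε t : ℝ} (hε : 0 < ε) (ht : t ∈ Icc 0 T) (htop : ∫⁻ p, ‖(Z t p).2‖ₑ ∂μ₀ = ∞)
    {c : ℝ≥0∞} (hc : 0 < c) : ∃ n : ℕ, μ₀ (fastSet T Z ε (1 / ((n : ℝ) + 1)) t) ≤ c := by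
  have := h.prob
  have := h.isProbabilityMeasure ht
  have hanti : Antitone fun n : ℕ => fastSet T Z ε (1 / ((n : ℝ) + 1)) t := by
    rintro n m hnm p ⟨s, ⟨hs, hst⟩, hp⟩
    exact ⟨s, ⟨hs, ball_subset_ball (one_div_le_one_div_of_le (by positivity)
      (by gcongr)) hst⟩, hp⟩
  have hempty : ⋂ n : ℕ, fastSet T Z ε (1 / ((n : ℝ) + 1)) t = ∅ := by
    rw [eq_empty_iff_forall_notMem]
    intro p hp
    have hd := h.vel p t ht
    rw [topField_eq_zero hk _ _ _ _ (by rw [h.lintegral_snd ht, htop])] at hd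
    have := hd.isLittleO.def hε
    rw [Filter.eventually_iff, mem_nhdsWithin_iff] at this
    obtain ⟨η, hη, hsub⟩ := this
    obtain ⟨n, hn⟩ := exists_nat_one_div_lt hη
    obtain ⟨s, ⟨hs, hst⟩, hp'⟩ := mem_iInter.1 hp n
    have := hsub ⟨ball_subset_ball hn.le hst, hs⟩
    simp only [smul_zero, sub_zero, mem_ofPred_eq, Real.norm_eq_abs] at this hp'
    exact absurd hp' (not_lt.2 this)
  have := tendsto_measure_iInter_atTop (μ := μ₀)
    (fun n : ℕ => h.nullMeasurableSet_fastSet (η := 1 / ((n : ℝ) + 1)) (ε := ε) ht) hanti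
    ⟨0, measure_ne_top _ _⟩
  rw [hempty, measure_empty] at this
  obtain ⟨n, hn⟩ := (this.eventually (ge_mem_nhds hc)).exists
  exact ⟨n, hn⟩

theorem exists_position_bound (h : IsMeasureFlow k T μ₀ F Z) {c : ℝ≥0∞} (hc : 0 < c) :
    ∃ R : ℝ, μ₀ {p | ∃ s ∈ Icc 0 T, p ∈ {p | R < ‖(Z s p).1‖}} ≤ c := by
  have := h.prob
  have hnull : ∀ n : ℕ, NullMeasurableSet {p | ∃ s ∈ Icc 0 T, p ∈ {p | (n : ℝ) < ‖(Z s p).1‖}}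
      μ₀ := fun n => nullMeasurableSet_exists_mem
    (fun s hs => nullMeasurableSet_lt aemeasurable_const (h.aemeasurable s hs).fst.norm)
    fun p => by
      have hc : Continuous fun s : ↥(Icc 0 T) => (Z s p).1 := (h.continuousOn_pos p).domRestrict
      exact isOpen_lt (f := fun _ : ↥(Icc 0 T) => (n : ℝ)) (g := fun s => ‖(Z s p).1‖)
        (by fun_prop) (by fun_prop)
  have hanti : Antitone fun n : ℕ =>
      {p | ∃ s ∈ Icc 0 T, p ∈ {p | (n : ℝ) < ‖(Z s p).1‖}} := by
    rintro n m hnm p ⟨s, hs, hp⟩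
    exact ⟨s, hs, show (n : ℝ) < _ from lt_of_le_of_lt (Nat.cast_le.2 hnm) hp⟩
  have hempty : ⋂ n : ℕ, {p | ∃ s ∈ Icc 0 T, p ∈ {p | (n : ℝ) < ‖(Z s p).1‖}} = ∅ := by
    rw [eq_empty_iff_forall_notMem]
    intro p hp
    obtain ⟨C, hC⟩ := isCompact_Icc.exists_bound_of_continuousOn (h.continuousOn_pos p)
    obtain ⟨n, hn⟩ := exists_nat_gt C
    obtain ⟨s, hs, hp'⟩ := mem_iInter.1 hp n
    exact absurd (hC s hs) (not_le.2 (hn.trans hp'))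
  have := tendsto_measure_iInter_atTop (μ := μ₀) hnull hanti ⟨0, measure_ne_top _ _⟩
  rw [hempty, measure_empty] at this
  obtain ⟨n, hn⟩ := (this.eventually (ge_mem_nhds hc)).exists
  exact ⟨n, hn⟩

theorem exists_small_closedBall [Nontrivial E] [(volume : Measure E).IsAddHaarMeasure]
    {A c : ℝ≥0∞} (hA : A ≠ ∞) (hc : 0 < c) :
    ∃ r > 0, A * volume (closedBall (0 : E) r) ≤ c := by
  have hpow : Filter.Tendsto (fun n : ℕ => A * volume (closedBall (0 : E) (1 / ((n : ℝ) + 1))))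
      Filter.atTop (nhds 0) := by
    have hset : ⋂ n : ℕ, closedBall (0 : E) (1 / ((n : ℝ) + 1)) = {0} := by
      ext x
      simp only [mem_iInter, mem_closedBall, dist_zero_right, mem_singleton_iff]
      refine ⟨fun hx => ?_, ?_⟩
      · by_contra hne
        obtain ⟨n, hn⟩ := exists_nat_one_div_lt (norm_pos_iff.2 hne)
        exact absurd (hx n) (not_le.2 hn)
      · rintro rfl n
        rw [norm_zero]; positivity
    have := tendsto_measure_iInter_atTop (μ := (volume : Measure E))
      (s := fun n : ℕ => closedBall (0 : E) (1 / ((n : ℝ) + 1)))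
      (fun n => isClosed_closedBall.measurableSet.nullMeasurableSet)
      (fun n m hnm => closedBall_subset_closedBall (one_div_le_one_div_of_le (by positivity)
        (by gcongr))) ⟨0, measure_closedBall_lt_top.ne⟩
    rw [hset, measure_singleton] at this
    simpa using ENNReal.Tendsto.const_mul this (Or.inr hA)
  obtain ⟨n, hn⟩ := (hpow.eventually (ge_mem_nhds hc)).exists
  exact ⟨_, by positivity, hn⟩

theorem half_lt_fastSet (h : IsMeasureFlow k T μ₀ F Z) (hk : IsCommKernel k K₁ K₀ L)
    [(volume : Measure E).IsAddHaarMeasure] (hT : 0 < T) {B : ℝ≥0∞} {R ε : ℝ}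
    (hF : ∀ t ∈ Icc 0 T, F t ≤ B • volume)
    (hR : μ₀ {p | ∃ s ∈ Icc 0 T, p ∈ {p | R < ‖(Z s p).1‖}} ≤ 1 / 5)
    (hε : B * volume (closedBall (0 : E) R) * volume (closedBall (0 : E) (2 * ε / K₁)) ≤ 1 / 5)
    {t η : ℝ} (ht : t ∈ Icc 0 T) (hη : 0 < η) (hfin : ∫⁻ p, ‖(Z t p).2‖ₑ ∂μ₀ ≠ ∞) :
    ¬ μ₀ (fastSet T Z ε η t) ≤ 1 / 2 := by
  intro hle
  have := h.prob
  have := h.isProbabilityMeasure ht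
  set S : Set (E × E) :=
    {p | ‖p.1‖ ≤ R ∧ ‖topField k (F t) (F t) p.1 p.2‖ ≤ ε} with hS
  have hSm : MeasurableSet S :=
    (measurableSet_le (f := fun p : E × E => ‖p.1‖) (by fun_prop) measurable_const).inter
      (measurableSet_le (measurable_topField hk _ _).norm measurable_const)
  have hS5 : μ₀ (Z t ⁻¹' S) ≤ 1 / 5 := by
    rw [← Measure.map_apply_of_aemeasurable (h.aemeasurable t ht) hSm, h.map_eq t ht]
    calc F t S ≤ B * volume S := hF t ht S
      _ ≤ B * (volume (closedBall (0 : E) (2 * ε / K₁)) * volume (closedBall (0 : E) R)) := by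
          gcongr
          exact volume_small_field hk _ _ (by rwa [h.lintegral_snd ht]) R ε
      _ ≤ 1 / 5 := by rwa [mul_comm (volume (closedBall (0 : E) (2 * ε / K₁))), ← mul_assoc]
  have hcov : (univ : Set (E × E)) ⊆ fastSet T Z ε η t ∪
      ({p | ∃ s ∈ Icc 0 T, p ∈ {p | R < ‖(Z s p).1‖}} ∪ Z t ⁻¹' S) := by
    intro p _
    by_contra hp
    simp only [mem_union, not_or] at hp
    obtain ⟨h1, h2, h3⟩ := hp
    refine h3 ⟨?_, ?_⟩
    · by_contra hcon
      exact h2 ⟨t, ht, not_le.1 hcon⟩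
    · refine norm_le_of_hasDerivWithinAt_of_lip hT ht hη (h.vel p t ht) fun s hs hst => ?_
      by_contra hcon
      exact h1 ⟨s, ⟨hs, by simpa [Real.dist_eq] using hst⟩, not_le.1 hcon⟩
  have h1 : (1 : ℝ≥0∞) ≤ 1 / 2 + (1 / 5 + 1 / 5) := by
    calc (1 : ℝ≥0∞) = μ₀ univ := measure_univ.symm
      _ ≤ _ := (measure_mono hcov).trans (measure_union_le _ _)
      _ ≤ _ := add_le_add hle ((measure_union_le _ _).trans (add_le_add hR hS5))
  have h2 : (1 / 2 + (1 / 5 + 1 / 5) : ℝ≥0∞) = ENNReal.ofReal (9 / 10) := by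
    rw [show (9 / 10 : ℝ) = 1 / 2 + (1 / 5 + 1 / 5) by norm_num,
      ENNReal.ofReal_add (by norm_num) (by norm_num),
      ENNReal.ofReal_add (by norm_num) (by norm_num), ENNReal.ofReal_div_of_pos (by norm_num),
      ENNReal.ofReal_div_of_pos (by norm_num)]
    simp
  rw [h2, ENNReal.one_le_ofReal] at h1
  norm_num at h1

/-- The first velocity moment stays bounded on the whole time interval. -/
theorem moment_bounded (h : IsMeasureFlow k T μ₀ F Z) (hk : IsCommKernel k K₁ K₀ L)
    [(volume : Measure E).IsAddHaarMeasure] (hT : 0 < T) {B : ℝ≥0∞} (hB : B ≠ ∞)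
    (hF : ∀ t ∈ Icc 0 T, F t ≤ B • volume) (h0 : ∫⁻ p, ‖p.2‖ₑ ∂μ₀ ≠ ∞) :
    ∃ c ≠ ∞, ∀ t ∈ Icc 0 T, ∫⁻ p, ‖(Z t p).2‖ₑ ∂μ₀ ≤ c := by
  rcases subsingleton_or_nontrivial E with hE | hE
  · refine ⟨0, by simp, fun t _ => ?_⟩
    simp [Subsingleton.elim _ (0 : E)]
  obtain ⟨R, hR⟩ := h.exists_position_bound (c := 1 / 5) (by simp)
  obtain ⟨r, hr, hrB⟩ := exists_small_closedBall (E := E)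
    (A := B * volume (closedBall (0 : E) R)) (c := 1 / 5)
    (ENNReal.mul_ne_top hB measure_closedBall_lt_top.ne) (by simp)
  set ε : ℝ := r * K₁ / 2 with hε
  have hεr : 2 * ε / K₁ = r := by rw [hε]; field_simp [hk.pos.ne']
  have hε0 : 0 < ε := by have := hk.pos; positivity
  have hK := hk.upper_pos
  refine bounded_of_baire (δ := 1 / (4 * K₀)) hT.le (by positivity)
    h.isClosed_moment_le
    (fun n : ℕ => {t | t ∈ Icc 0 T ∧ μ₀ (fastSet T Z ε (1 / ((n : ℝ) + 1)) t) ≤ 1 / 2})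
    (fun n => h.isClosed_fastSet_le _) (fun t ht => ⟨fun htop => ?_, ?_⟩) ?_ ?_ ?_
  · obtain ⟨n, hn⟩ := h.exists_fastSet_le hk hε0 ht htop (c := 1 / 2) (by simp)
    exact ⟨n, ht, hn⟩
  · rintro ⟨n, -, hn⟩
    by_contra hfin
    exact h.half_lt_fastSet hk hT hF hR (hεr.symm ▸ hrB) ht (by positivity) hfin hn
  · intro a ha b hb hab hbdd r hr t ht
    refine h.moment_le_two_mul hk ha hb ?_ hbdd hr ht
    rw [le_div_iff₀ (by positivity)] at hab
    linarith
  · intro a ha b hb hab htop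
    exact h.moment_eq_top_of_adjacent hk ha hb hab htop
  · simpa [h.zero] using h0

end IsMeasureFlow

theorem HasDerivWithinAt.Ici_of_Icc {G : Type*} [NormedAddCommGroup G] [NormedSpace ℝ G]
    {g : ℝ → G} {g' : G} {T t : ℝ} (ht : t ∈ Ico 0 T) (hg : HasDerivWithinAt g g' (Icc 0 T) t) :
    HasDerivWithinAt g g' (Ici t) t :=
  hg.mono_of_mem_nhdsWithin (Icc_mem_nhdsGE_of_mem ht)

/-- Grönwall's inequality on `[0, T]`, with the bound at the final time. -/
theorem norm_le_gronwallBound_Icc {G : Type*} [NormedAddCommGroup G] [NormedSpace ℝ G]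
    {g g' : ℝ → G} {T δ A ε : ℝ} (hA : 0 ≤ A) (hδ : 0 ≤ δ) (hε : 0 ≤ ε)
    (hg : ∀ t ∈ Icc 0 T, HasDerivWithinAt g (g' t) (Icc 0 T) t) (h0 : ‖g 0‖ ≤ δ)
    (hb : ∀ t ∈ Icc 0 T, ‖g' t‖ ≤ A * ‖g t‖ + ε) {t : ℝ} (ht : t ∈ Icc 0 T) :
    ‖g t‖ ≤ gronwallBound δ A ε T := by
  have h1 := norm_le_gronwallBound_of_norm_deriv_right_le
    (fun t ht => (hg t ht).continuousWithinAt)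
    (fun t ht => (hg t (Ico_subset_Icc_self ht)).Ici_of_Icc ht) h0
    (fun t ht => hb t (Ico_subset_Icc_self ht)) t ht
  exact h1.trans (gronwallBound_mono hδ hε hA (by linarith [ht.2]))

theorem gronwallBound_nonneg' {δ A ε T : ℝ} (hA : 0 ≤ A) (hδ : 0 ≤ δ) (hε : 0 ≤ ε) (hT : 0 ≤ T) :
    δ ≤ gronwallBound δ A ε T := by
  have := gronwallBound_mono hδ hε hA hT
  rwa [gronwallBound_x0] at this

namespace IsMeasureFlow

variable {E : Type*} [NormedAddCommGroup E] [InnerProductSpace ℝ E] [FiniteDimensional ℝ E]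
  [MeasureSpace E] [BorelSpace E] {k : ℝ → ℝ} {K₁ K₀ T : ℝ} {L : NNReal}
  {μ₀ : Measure (E × E)} {F : ℝ → Measure (E × E)} {Z : ℝ → E × E → E × E}

theorem moment_le_pow (h : IsMeasureFlow k T μ₀ F Z) (hk : IsCommKernel k K₁ K₀ L)
    (hbdd : ∃ c ≠ ∞, ∀ t ∈ Icc 0 T, ∫⁻ p, ‖(Z t p).2‖ₑ ∂μ₀ ≤ c) (j : ℕ) :
    ∀ t ∈ Icc 0 T, 4 * K₀ * t ≤ j → ∫⁻ p, ‖(Z t p).2‖ₑ ∂μ₀ ≤ 2 ^ j * ∫⁻ p, ‖p.2‖ₑ ∂μ₀ := by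
  have hK := hk.upper_pos
  induction j with
  | zero =>
    intro t ht htj
    have : t = 0 := by
      refine le_antisymm ?_ ht.1
      by_contra hcon
      have : 0 < 4 * K₀ * t := by have := not_le.1 hcon; positivity
      simp at htj; linarith
    subst this
    simp [h.zero]
  | succ j ih =>
    intro t ht htj
    set s : ℝ := max 0 (t - 1 / (4 * K₀)) with hs
    have hpos : 0 < 1 / (4 * K₀) := by positivity
    have hst : s ≤ t := max_le ht.1 (by linarith)
    have hsm : s ∈ Icc 0 T := ⟨le_max_left _ _, hst.trans ht.2⟩
    have hts : t - s ≤ 1 / (4 * K₀) := by linarith [le_max_right 0 (t - 1 / (4 * K₀))]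
    have hsj : 4 * K₀ * s ≤ j := by
      rw [hs, mul_max_of_nonneg _ _ (by positivity)]
      refine max_le (by simp) ?_
      push_cast at htj
      rw [mul_sub, mul_one_div_cancel (by positivity)]
      linarith
    obtain ⟨c, hc, hbd⟩ := hbdd
    have hsub : uIcc s t ⊆ Icc 0 T := (ordConnected_Icc).uIcc_subset hsm ht
    have := h.moment_le_two_mul hk hsm ht (r := s) (t := t) ?_
      ⟨c, hc, fun r hr => hbd r (hsub hr)⟩ left_mem_uIcc right_mem_uIcc
    · refine this.trans ?_
      rw [pow_succ', mul_assoc]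
      gcongr
      exact ih s hsm hsj
    · rw [abs_sub_comm, abs_of_nonneg (by linarith)]
      rw [le_div_iff₀ (by positivity)] at hts
      linarith

theorem norm_vel_le (h : IsMeasureFlow k T μ₀ F Z) (hk : IsCommKernel k K₁ K₀ L) {n r : ℝ}
    (hn : 0 ≤ n) (hr : 0 ≤ r)
    (hbdd : ∀ t ∈ Icc 0 T, (∫⁻ p, ‖(Z t p).2‖ₑ ∂μ₀).toReal ≤ n) {p : E × E} (hp : ‖p.2‖ ≤ r)
    {t : ℝ} (ht : t ∈ Icc 0 T) : ‖(Z t p).2‖ ≤ gronwallBound r K₀ (K₀ * n) T := by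
  have hK := hk.upper_pos
  refine norm_le_gronwallBound_Icc (g := fun τ => (Z τ p).2) hK.le hr (by positivity) (h.vel p)
    (by simpa [h.zero] using hp) (fun s hs => ?_) ht
  have := h.isProbabilityMeasure hs
  refine (norm_topField_le hk _ _ _ _).trans ?_
  rw [h.lintegral_snd hs, mul_add, add_comm]
  gcongr
  exact hbdd s hs

theorem norm_pos_le (h : IsMeasureFlow k T μ₀ F Z) {R r : ℝ} {p : E × E} (hp : ‖p.1‖ ≤ r)
    (hR : ∀ t ∈ Icc 0 T, ‖(Z t p).2‖ ≤ R) {t : ℝ} (ht : t ∈ Icc 0 T) :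
    ‖(Z t p).1‖ ≤ r + R * T := by
  have h0 : (0 : ℝ) ∈ Icc 0 T := ⟨le_rfl, ht.1.trans ht.2⟩
  have hR0 : 0 ≤ R := (norm_nonneg _).trans (hR t ht)
  have := (convex_Icc 0 T).norm_image_sub_le_of_norm_hasDerivWithin_le
    (f := fun τ => (Z τ p).1) (h.pos p) hR h0 ht
  simp only [h.zero, sub_zero, Real.norm_eq_abs, abs_of_nonneg ht.1] at this
  have h1 := norm_sub_norm_le (Z t p).1 p.1
  have h2 : R * t ≤ R * T := by gcongr; exact ht.2
  linarith

end IsMeasureFlow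

section Density

variable {E : Type*} [NormedAddCommGroup E] [InnerProductSpace ℝ E] [FiniteDimensional ℝ E]
  [MeasureSpace E] [BorelSpace E]

/-- A probability measure supported in a phase-space box. -/
structure IsBoxMeasure (μ : Measure (E × E)) (Q R : ℝ) : Prop where
  prob : IsProbabilityMeasure μ
  mem_box : ∀ᵐ p ∂μ, p ∈ closedBall (0 : E) Q ×ˢ closedBall (0 : E) R

/-- The Lipschitz constant of the mass function of a box measure with density at most `B`. -/
def massLip (E : Type*) [NormedAddCommGroup E] [InnerProductSpace ℝ E] [MeasureSpace E]
    (B Q R : ℝ) : ℝ :=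
  B * (volume.real (closedBall (0 : E) R) * (volume.real (closedBall (0 : E) 1) *
    (Module.finrank ℝ E * (6 * Q) ^ (Module.finrank ℝ E - 1))))

theorem massLip_nonneg {B Q R : ℝ} (hB : 0 ≤ B) (hQ : 0 ≤ Q) : 0 ≤ massLip E B Q R := by
  unfold massLip; positivity

theorem volume_real_annulus_le [(volume : Measure E).IsAddHaarMeasure] (x : E) {Q r δ : ℝ}
    (hr : 0 ≤ r) (hδ : 0 ≤ δ) (hQ : r + δ ≤ 6 * Q) :
    volume.real (closedBall x (r + δ) \ closedBall x r) ≤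
      volume.real (closedBall (0 : E) 1) *
        (Module.finrank ℝ E * (6 * Q) ^ (Module.finrank ℝ E - 1)) * δ := by
  set n := Module.finrank ℝ E
  rw [measureReal_sdiff (closedBall_subset_closedBall (by linarith))
    isClosed_closedBall.measurableSet measure_closedBall_lt_top.ne,
    measureReal_def, measureReal_def, Measure.addHaar_closedBall' _ _ (by linarith : 0 ≤ r + δ),
    Measure.addHaar_closedBall' _ _ hr, ENNReal.toReal_mul, ENNReal.toReal_mul,
    ENNReal.toReal_ofReal (by positivity), ENNReal.toReal_ofReal (by positivity), ← sub_mul]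
  have h1 := abs_pow_sub_pow_le (r + δ) r n
  rw [add_sub_cancel_left, abs_of_nonneg hδ, abs_of_nonneg hr, abs_of_nonneg (by linarith : 0 ≤ r + δ),
    max_eq_left (by linarith)] at h1
  calc ((r + δ) ^ n - r ^ n) * (volume (closedBall (0 : E) 1)).toReal
      ≤ (δ * n * (6 * Q) ^ (n - 1)) * (volume (closedBall (0 : E) 1)).toReal := by
        gcongr
        refine (le_abs_self _).trans (h1.trans ?_)
        gcongr
    _ = _ := by rw [← measureReal_def]; ring

theorem massBall_add_le [(volume : Measure E).IsAddHaarMeasure] {μ : Measure (E × E)}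
    {B Q R : ℝ} (hB : 0 ≤ B) (hμ : IsBoxMeasure μ Q R) (hμB : μ ≤ ENNReal.ofReal B • volume)
    (x : E) {r δ : ℝ} (hr : 0 ≤ r) (hδ : 0 ≤ δ) (hQ : r + δ ≤ 6 * Q) :
    massBall μ x (r + δ) ≤ massBall μ x r + massLip E B Q R * δ := by
  have := hμ.prob
  have hsub : (closedBall x (r + δ) ×ˢ univ : Set (E × E)) ⊆ (closedBall x r ×ˢ univ) ∪
      ((closedBall x (r + δ) \ closedBall x r) ×ˢ univ) := by
    rintro ⟨y, w⟩ ⟨hy, -⟩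
    by_cases h : y ∈ closedBall x r
    · exact Or.inl ⟨h, mem_univ _⟩
    · exact Or.inr ⟨⟨hy, h⟩, mem_univ _⟩
  have h1 : massBall μ x (r + δ) ≤ massBall μ x r +
      μ.real ((closedBall x (r + δ) \ closedBall x r) ×ˢ univ) :=
    (measureReal_mono hsub).trans (measureReal_union_le _ _)
  refine h1.trans (add_le_add_right ?_ _)
  have h2 : μ ((closedBall x (r + δ) \ closedBall x r) ×ˢ univ) ≤ ENNReal.ofReal B *
      (volume (closedBall x (r + δ) \ closedBall x r) * volume (closedBall (0 : E) R)) := by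
    calc _ ≤ μ ((closedBall x (r + δ) \ closedBall x r) ×ˢ closedBall (0 : E) R) := by
          refine measure_mono_ae ?_
          filter_upwards [hμ.mem_box] with p hp hp'
          exact ⟨hp'.1, hp.2⟩
      _ ≤ _ := by
          refine (hμB _).trans_eq ?_
          rw [Measure.smul_apply, smul_eq_mul, Measure.volume_eq_prod, Measure.prod_prod]
  have hfin : volume (closedBall x (r + δ) \ closedBall x r) ≠ ∞ :=
    ne_top_of_le_ne_top measure_closedBall_lt_top.ne (measure_mono sdiff_subset)
  have h3 := ENNReal.toReal_mono (ENNReal.mul_ne_top ENNReal.ofReal_ne_top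
    (ENNReal.mul_ne_top hfin (measure_closedBall_lt_top (x := (0 : E)) (r := R)).ne)) h2
  rw [ENNReal.toReal_mul, ENNReal.toReal_mul, ENNReal.toReal_ofReal hB] at h3
  refine h3.trans ?_
  have h4 := volume_real_annulus_le x hr hδ hQ
  rw [measureReal_def] at h4
  calc _ ≤ B * ((volume.real (closedBall (0 : E) 1) *
        (Module.finrank ℝ E * (6 * Q) ^ (Module.finrank ℝ E - 1)) * δ) *
        (volume (closedBall (0 : E) R)).toReal) := by gcongr
    _ = _ := by rw [massLip, measureReal_def (s := closedBall (0 : E) R)]; ring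

theorem massBall_mono (μ : Measure (E × E)) [IsFiniteMeasure μ] {x x' : E} {r r' : ℝ}
    (h : dist x x' + r ≤ r') : massBall μ x r ≤ massBall μ x' r' :=
  measureReal_mono (prod_mono (closedBall_subset_closedBall' (by linarith)) Subset.rfl)

theorem abs_massBall_sub_le [(volume : Measure E).IsAddHaarMeasure] {μ : Measure (E × E)}
    {B Q R : ℝ} (hB : 0 ≤ B) (hμ : IsBoxMeasure μ Q R) (hμB : μ ≤ ENNReal.ofReal B • volume)
    {x x' : E} {r r' : ℝ} (hr : 0 ≤ r) (hr' : 0 ≤ r') (hr2 : r ≤ 2 * Q) (hr2' : r' ≤ 2 * Q)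
    (hx : dist x x' ≤ 2 * Q) :
    |massBall μ x r - massBall μ x' r'| ≤ massLip E B Q R * (dist x x' + |r - r'|) := by
  have := hμ.prob
  have key : ∀ {x x' : E} {r r' : ℝ}, 0 ≤ r → 0 ≤ r' → r ≤ 2 * Q → r' ≤ 2 * Q →
      dist x x' ≤ 2 * Q →
      massBall μ x r ≤ massBall μ x' r' + massLip E B Q R * (dist x x' + |r - r'|) := by
    intro x x' r r' hr hr' hr2 hr2' hx
    refine le_trans (massBall_mono μ ?_) (massBall_add_le hB hμ hμB x' hr'
      (by positivity) ?_)
    · linarith [le_abs_self (r - r')]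
    · have : |r - r'| ≤ 2 * Q := abs_sub_le_iff.2 ⟨by linarith, by linarith⟩
      linarith
  rw [abs_sub_le_iff]
  constructor
  · linarith [key hr hr' hr2 hr2' hx]
  · have := key hr' hr hr2' hr2 (by rwa [dist_comm])
    rw [dist_comm x' x, abs_sub_comm r' r] at this
    linarith

variable {k : ℝ → ℝ} {K₁ K₀ : ℝ} {L : NNReal}

theorem dist_le_of_mem_closedBall_zero {x y : E} {Q : ℝ} (hx : x ∈ closedBall (0 : E) Q)
    (hy : y ∈ closedBall (0 : E) Q) : dist x y ≤ 2 * Q := by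
  have := dist_triangle_right x y 0
  rw [mem_closedBall] at hx hy
  linarith

/-- The integrand of the interaction field is Lipschitz in all its arguments. -/
theorem norm_integrand_sub_le [(volume : Measure E).IsAddHaarMeasure]
    (hk : IsCommKernel k K₁ K₀ L) {μ : Measure (E × E)}
    {B Q R : ℝ} (hB : 0 ≤ B) (hμ : IsBoxMeasure μ Q R) (hμB : μ ≤ ENNReal.ofReal B • volume)
    {x x' v v' : E} {p p' : E × E} (hx : x ∈ closedBall (0 : E) Q)
    (hx' : x' ∈ closedBall (0 : E) Q) (hv : v ∈ closedBall (0 : E) R)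
    (hp : p ∈ closedBall (0 : E) Q ×ˢ closedBall (0 : E) R)
    (hp' : p' ∈ closedBall (0 : E) Q ×ˢ closedBall (0 : E) R) :
    ‖k (massBall μ x (dist x p.1)) • (p.2 - v) - k (massBall μ x' (dist x' p'.1)) • (p'.2 - v')‖ ≤
      2 * R * (L * massLip E B Q R) * (2 * dist x x' + dist p.1 p'.1) +
        K₀ * (dist p.2 p'.2 + dist v v') := by
  have h1 : |k (massBall μ x (dist x p.1)) - k (massBall μ x' (dist x' p'.1))| ≤
      L * massLip E B Q R * (2 * dist x x' + dist p.1 p'.1) := by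
    have h2 := hk.lip.dist_le_mul (massBall μ x (dist x p.1)) (massBall μ x' (dist x' p'.1))
    rw [Real.dist_eq, Real.dist_eq] at h2
    have h3 := abs_massBall_sub_le hB hμ hμB (x := x) (x' := x') (dist_nonneg (x := x) (y := p.1))
      (dist_nonneg (x := x') (y := p'.1)) (dist_le_of_mem_closedBall_zero hx hp.1)
      (dist_le_of_mem_closedBall_zero hx' hp'.1) (dist_le_of_mem_closedBall_zero hx hx')
    have h4 : |dist x p.1 - dist x' p'.1| ≤ dist x x' + dist p.1 p'.1 := by
      have := dist_dist_dist_le x p.1 x' p'.1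
      rwa [Real.dist_eq] at this
    have h5 := massLip_nonneg (E := E) (R := R) hB
      (dist_nonneg.trans hx : (0:ℝ) ≤ Q)
    calc _ ≤ (L : ℝ) * (massLip E B Q R * (dist x x' + |dist x p.1 - dist x' p'.1|)) :=
          h2.trans (by gcongr)
      _ ≤ (L : ℝ) * (massLip E B Q R * (dist x x' + (dist x x' + dist p.1 p'.1))) := by gcongr
      _ = _ := by ring
  have hsplit : k (massBall μ x (dist x p.1)) • (p.2 - v) -
      k (massBall μ x' (dist x' p'.1)) • (p'.2 - v') =
      (k (massBall μ x (dist x p.1)) - k (massBall μ x' (dist x' p'.1))) • (p.2 - v) +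
      k (massBall μ x' (dist x' p'.1)) • ((p.2 - p'.2) - (v - v')) := by
    rw [sub_smul, show p.2 - p'.2 - (v - v') = (p.2 - v) - (p'.2 - v') by abel,
      smul_sub _ (p.2 - v)]
    abel
  rw [hsplit]
  refine (norm_add_le _ _).trans (add_le_add ?_ ?_)
  · rw [norm_smul, Real.norm_eq_abs, ← dist_eq_norm]
    calc _ ≤ (L * massLip E B Q R * (2 * dist x x' + dist p.1 p'.1)) * (2 * R) :=
          mul_le_mul h1 (dist_le_of_mem_closedBall_zero hp.2 hv) dist_nonneg
            ((abs_nonneg _).trans h1)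
      _ = _ := by ring
  · rw [norm_smul, Real.norm_eq_abs]
    have hK := hk.upper_pos
    gcongr
    · exact hk.abs_le _
    · refine (norm_sub_le _ _).trans ?_
      rw [dist_eq_norm, dist_eq_norm]

theorem IsBoxMeasure.moment_ne_top {ν : Measure (E × E)} {Q R : ℝ} (hν : IsBoxMeasure ν Q R) :
    (∫⁻ p, ‖p.2‖ₑ ∂ν) ≠ ∞ := by
  have := hν.prob
  rw [← integrable_snd_iff]
  refine Integrable.of_bound measurable_snd.aestronglyMeasurable R ?_
  filter_upwards [hν.mem_box] with p hp
  simpa using hp.2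

theorem IsBoxMeasure.integrable_field {ν : Measure (E × E)} {Q R : ℝ} (hν : IsBoxMeasure ν Q R)
    (hk : IsCommKernel k K₁ K₀ L) (μ : Measure (E × E)) [IsProbabilityMeasure μ] (x v : E) :
    Integrable (fun p : E × E => k (massBall μ x (dist x p.1)) • (p.2 - v)) ν := by
  have := hν.prob
  exact (integrable_field_iff hk μ ν x v).2 ((integrable_snd_iff ν).2 hν.moment_ne_top)

/-- The spatial Lipschitz constant of the interaction field. -/
def fieldLip (E : Type*) [NormedAddCommGroup E] [InnerProductSpace ℝ E] [MeasureSpace E]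
    (L K₀ B Q R : ℝ) : ℝ := 2 * (2 * R * (L * massLip E B Q R)) + K₀

theorem norm_topField_sub_le [(volume : Measure E).IsAddHaarMeasure]
    (hk : IsCommKernel k K₁ K₀ L) {μ ν : Measure (E × E)}
    {B Q R : ℝ} (hB : 0 ≤ B) (hμ : IsBoxMeasure μ Q R) (hμB : μ ≤ ENNReal.ofReal B • volume)
    (hν : IsBoxMeasure ν Q R) {q q' : E × E}
    (hq : q ∈ closedBall (0 : E) Q ×ˢ closedBall (0 : E) R)
    (hq' : q' ∈ closedBall (0 : E) Q ×ˢ closedBall (0 : E) R) :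
    ‖topField k μ ν q.1 q.2 - topField k μ ν q'.1 q'.2‖ ≤
      fieldLip E L K₀ B Q R * dist q q' := by
  have := hμ.prob
  have := hν.prob
  rw [topField, topField, ← integral_sub (hν.integrable_field hk μ _ _)
    (hν.integrable_field hk μ _ _)]
  have hbound : ∀ᵐ p ∂ν, ‖k (massBall μ q.1 (dist q.1 p.1)) • (p.2 - q.2) -
      k (massBall μ q'.1 (dist q'.1 p.1)) • (p.2 - q'.2)‖ ≤ fieldLip E L K₀ B Q R * dist q q' := by
    filter_upwards [hν.mem_box] with p hp
    refine (norm_integrand_sub_le hk hB hμ hμB hq.1 hq'.1 hq.2 hp hp).trans ?_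
    rw [dist_self, dist_self, add_zero, zero_add, fieldLip, add_mul]
    have hQ : (0 : ℝ) ≤ Q := dist_nonneg.trans hq.1
    have hR : (0 : ℝ) ≤ R := dist_nonneg.trans hq.2
    have h5 := massLip_nonneg (E := E) (R := R) hB hQ
    have hK := hk.upper_pos
    have h1 : dist q.1 q'.1 ≤ dist q q' := le_max_left _ _
    have h2 : dist q.2 q'.2 ≤ dist q q' := le_max_right _ _
    calc _ ≤ 2 * R * (L * massLip E B Q R) * (2 * dist q q') + K₀ * dist q q' := by gcongr
      _ = _ := by ring
  simpa using norm_integral_le_of_norm_le_const hbound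

end Density

section Box

variable {E : Type*} [NormedAddCommGroup E] [InnerProductSpace ℝ E] [FiniteDimensional ℝ E]
  [MeasureSpace E] [BorelSpace E] {k : ℝ → ℝ} {K₁ K₀ : ℝ} {L : NNReal}

theorem IsBoxMeasure.norm_topField_le {ν : Measure (E × E)} {Q R : ℝ} (hν : IsBoxMeasure ν Q R)
    (hk : IsCommKernel k K₁ K₀ L) (μ : Measure (E × E)) (x : E) {v : E}
    (hv : v ∈ closedBall (0 : E) R) : ‖topField k μ ν x v‖ ≤ K₀ * (2 * R) := by
  have := hν.prob
  have hK := hk.upper_pos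
  have : ∀ᵐ p ∂ν, ‖k (massBall μ x (dist x p.1)) • (p.2 - v)‖ ≤ K₀ * (2 * R) := by
    filter_upwards [hν.mem_box] with p hp
    rw [norm_smul, ← dist_eq_norm]
    gcongr
    · exact hk.abs_le _
    · exact dist_le_of_mem_closedBall_zero hp.2 hv
  rw [topField]
  simpa using norm_integral_le_of_norm_le_const this

/-- An explicit Euler step for the velocity does not leave the ball of admissible velocities. -/
theorem IsBoxMeasure.add_smul_topField_mem {ν : Measure (E × E)} {Q R h : ℝ}
    (hν : IsBoxMeasure ν Q R) (hk : IsCommKernel k K₁ K₀ L) (μ : Measure (E × E))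
    [IsProbabilityMeasure μ] (x : E) {v : E} (hv : v ∈ closedBall (0 : E) R) (hh : 0 ≤ h)
    (hhK : h * K₀ ≤ 1) : v + h • topField k μ ν x v ∈ closedBall (0 : E) R := by
  have := hν.prob
  set a := ∫ p, k (massBall μ x (dist x p.1)) ∂ν with ha
  have ha0 : 0 ≤ a := hk.pos.le.trans (weight_integral_ge hk μ ν x)
  have ha1 : h * a ≤ 1 :=
    (mul_le_mul_of_nonneg_left (weight_integral_le hk μ ν x) hh).trans hhK
  have hsub := topField_sub hk μ ν x v 0 hν.moment_ne_top
  have hJ : ‖topField k μ ν x 0‖ ≤ a * R := by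
    rw [ha, ← integral_mul_const]
    refine norm_integral_le_of_norm_le ((integrable_weight hk μ ν x).mul_const R) ?_
    filter_upwards [hν.mem_box] with p hp
    rw [sub_zero, norm_smul, Real.norm_of_nonneg (hk.nonneg _)]
    have := hk.nonneg (massBall μ x (dist x p.1))
    gcongr
    simpa using hp.2
  have hv' : ‖v‖ ≤ R := by simpa using hv
  have heq : v + h • topField k μ ν x v = (1 - h * a) • v + h • topField k μ ν x 0 := by
    rw [sub_eq_iff_eq_add.1 hsub, sub_zero, ← ha]
    module
  rw [mem_closedBall_zero_iff, heq]
  calc _ ≤ (1 - h * a) * ‖v‖ + h * ‖topField k μ ν x 0‖ := by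
        refine (norm_add_le _ _).trans ?_
        rw [norm_smul, norm_smul, Real.norm_of_nonneg (by linarith), Real.norm_of_nonneg hh]
    _ ≤ (1 - h * a) * R + h * (a * R) := by
        have : 0 ≤ 1 - h * a := by linarith
        gcongr
    _ = R := by ring

/-- One step of the splitting scheme: free transport followed by an explicit Euler kick. -/
def eulerStep (k : ℝ → ℝ) (μ : Measure (E × E)) (h : ℝ) (q : E × E) : E × E :=
  (q.1 + h • q.2, q.2 + h • topField k μ μ (q.1 + h • q.2) q.2)

theorem measurable_eulerStep (hk : IsCommKernel k K₁ K₀ L) (μ : Measure (E × E))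
    [IsProbabilityMeasure μ] (h : ℝ) : Measurable (eulerStep k μ h) := by
  have := (measurable_topField hk μ μ).comp (f := fun q : E × E => (q.1 + h • q.2, q.2))
    (by fun_prop)
  exact (by fun_prop : Measurable fun q : E × E => q.1 + h • q.2).prodMk
    (measurable_snd.add (this.const_smul h))

theorem volume_preimage_shear [(volume : Measure E).IsAddHaarMeasure] (h : ℝ) {U : Set (E × E)}
    (hU : MeasurableSet U) :
    (volume : Measure (E × E)) ((fun q : E × E => (q.1 + h • q.2, q.2)) ⁻¹' U) = volume U := by
  have hm : Measurable fun q : E × E => (q.1 + h • q.2, q.2) := by fun_prop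
  rw [Measure.volume_eq_prod, Measure.prod_apply_symm (hm hU), Measure.prod_apply_symm hU]
  refine lintegral_congr fun v => ?_
  exact measure_preimage_add_right volume (h • v) ((fun x => (x, v)) ⁻¹' U)

theorem volume_preimage_eulerStep_le [(volume : Measure E).IsAddHaarMeasure]
    (hk : IsCommKernel k K₁ K₀ L) {μ : Measure (E × E)} {Q R h : ℝ} (hμ : IsBoxMeasure μ Q R)
    (hh : 0 ≤ h) (hhK : h * K₀ ≤ 1 / 2) {U : Set (E × E)} (hU : MeasurableSet U) :
    (volume : Measure (E × E)) (eulerStep k μ h ⁻¹' U) ≤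
      ENNReal.ofReal (Real.exp (2 * (h * K₀)) ^ Module.finrank ℝ E) * volume U := by
  have := hμ.prob
  set G : E × E → E × E := fun q => (q.1, q.2 + h • topField k μ μ q.1 q.2) with hG
  have hGm : Measurable G :=
    measurable_fst.prodMk (measurable_snd.add ((measurable_topField hk μ μ).const_smul h))
  have : eulerStep k μ h ⁻¹' U = (fun q : E × E => (q.1 + h • q.2, q.2)) ⁻¹' (G ⁻¹' U) := rfl
  rw [this, volume_preimage_shear h (hGm hU), Measure.volume_eq_prod,
    Measure.prod_apply (hGm hU), Measure.prod_apply hU,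
    ← lintegral_const_mul' _ _ ENNReal.ofReal_ne_top]
  refine lintegral_mono fun x => ?_
  set a := ∫ p, k (massBall μ x (dist x p.1)) ∂μ with ha
  have ha0 : 0 ≤ a := hk.pos.le.trans (weight_integral_ge hk μ μ x)
  have ha1 : h * a ≤ h * K₀ := mul_le_mul_of_nonneg_left (weight_integral_le hk μ μ x) hh
  have hset : Prod.mk x ⁻¹' (G ⁻¹' U) =
      (fun v => (1 - h * a) • v) ⁻¹' ((fun w => w + h • topField k μ μ x 0) ⁻¹'
        (Prod.mk x ⁻¹' U)) := by
    ext v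
    have hsub := topField_sub hk μ μ x v 0 hμ.moment_ne_top
    have heq : v + h • topField k μ μ x v = (1 - h * a) • v + h • topField k μ μ x 0 := by
      rw [sub_eq_iff_eq_add.1 hsub, sub_zero, ← ha]
      module
    simp only [hG, mem_preimage, heq]
  change volume (Prod.mk x ⁻¹' (G ⁻¹' U)) ≤ _
  rw [hset, Measure.addHaar_preimage_smul volume (by linarith : 1 - h * a ≠ 0),
    measure_preimage_add_right]
  gcongr
  have hpos : 0 < 1 - h * a := by linarith
  rw [abs_of_nonneg (by positivity), ← inv_pow]
  gcongr
  rw [inv_le_iff_one_le_mul₀ hpos]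
  have h1 := Real.add_one_le_exp (2 * (h * K₀))
  have h2 : 0 ≤ h * K₀ := mul_nonneg hh hk.upper_pos.le
  calc (1 : ℝ) ≤ (2 * (h * K₀) + 1) * (1 - h * K₀) := by nlinarith
    _ ≤ Real.exp (2 * (h * K₀)) * (1 - h * a) := by gcongr; linarith

end Box

/-- Second-order consistency of an Euler step for a `C¹` curve. -/
theorem norm_sub_sub_smul_le {G : Type*} [NormedAddCommGroup G] [NormedSpace ℝ G]
    {g g' : ℝ → G} {s s' M : ℝ} {c : G} (hs : s ≤ s')
    (hg : ∀ t ∈ Icc s s', HasDerivWithinAt g (g' t) (Icc s s') t)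
    (hM : ∀ t ∈ Icc s s', ‖g' t - c‖ ≤ M) : ‖g s' - g s - (s' - s) • c‖ ≤ M * (s' - s) := by
  have := (convex_Icc s s').norm_image_sub_le_of_norm_hasDerivWithin_le
    (f := fun t => g t - t • c) (f' := fun t => g' t - c) (fun t ht => by
      have := (hg t ht).sub ((hasDerivWithinAt_id t (Icc s s')).smul_const c)
      rw [one_smul] at this
      exact this)
    hM (left_mem_Icc.2 hs) (right_mem_Icc.2 hs)
  rw [Real.norm_of_nonneg (by linarith)] at this
  refine le_of_eq_of_le ?_ this
  congr 1
  rw [sub_smul]; abel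

/-- A discrete Grönwall inequality. -/
theorem discrete_gronwall_of_step {e : ℕ → ℝ} {n : ℕ} {A c : ℝ} (hA : 0 ≤ A) (hc : 0 ≤ c)
    (h0 : e 0 ≤ 0) (hstep : ∀ i < n, e (i + 1) ≤ (1 + A) * e i + c) :
    ∀ i ≤ n, e i ≤ i * c * (1 + A) ^ i := by
  intro i
  induction i with
  | zero => intro _; simpa using h0
  | succ i ih =>
    intro hi
    have h1 := hstep i (by omega)
    have h2 := ih (by omega)
    have h3 : (1 : ℝ) ≤ (1 + A) ^ (i + 1) := one_le_pow₀ (by linarith)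
    calc e (i + 1) ≤ (1 + A) * (i * c * (1 + A) ^ i) + c * (1 + A) ^ (i + 1) := by
          refine h1.trans (add_le_add (by gcongr) (le_mul_of_one_le_right hc h3))
      _ = _ := by push_cast; ring

/-- A measure flow whose trajectories, started from a phase-space box carrying the initial measure,
stay in a larger box. -/
structure IsConfinedFlow {E : Type*} [NormedAddCommGroup E] [InnerProductSpace ℝ E]
    [MeasureSpace E] (k : ℝ → ℝ) (T : ℝ) (μ₀ : Measure (E × E)) (F : ℝ → Measure (E × E))
    (Z : ℝ → E × E → E × E) (Rx Rv Q R : ℝ) : Prop extends IsMeasureFlow k T μ₀ F Z where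
  init : ∀ᵐ p ∂μ₀, p ∈ closedBall (0 : E) Rx ×ˢ closedBall (0 : E) Rv
  conf : ∀ p ∈ closedBall (0 : E) Rx ×ˢ closedBall (0 : E) Rv, ∀ t ∈ Icc 0 T,
    Z t p ∈ closedBall (0 : E) Q ×ˢ closedBall (0 : E) R
  pos_le : Rx + R * T ≤ Q
  vel_le : Rv ≤ R
  pos_nonneg : 0 ≤ Rx
  vel_nonneg : 0 ≤ Rv

namespace IsConfinedFlow

variable {E : Type*} [NormedAddCommGroup E] [InnerProductSpace ℝ E] [FiniteDimensional ℝ E]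
  [MeasureSpace E] [BorelSpace E] {k : ℝ → ℝ} {K₁ K₀ T Rx Rv Q R B : ℝ} {L : NNReal}
  {μ₀ : Measure (E × E)} {F : ℝ → Measure (E × E)} {Z : ℝ → E × E → E × E}

theorem bound_nonneg (h : IsConfinedFlow k T μ₀ F Z Rx Rv Q R) : 0 ≤ R :=
  h.vel_nonneg.trans h.vel_le

theorem isBoxMeasure (h : IsConfinedFlow k T μ₀ F Z Rx Rv Q R) {t : ℝ} (ht : t ∈ Icc 0 T) :
    IsBoxMeasure (F t) Q R where
  prob := h.isProbabilityMeasure ht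
  mem_box := by
    rw [← h.map_eq t ht]
    refine (mem_ae_map_iff (h.aemeasurable t ht)
      (isClosed_closedBall.prod isClosed_closedBall).measurableSet).2 ?_
    filter_upwards [h.init] with p hp using h.conf p hp t ht

theorem dist_pos_le (h : IsConfinedFlow k T μ₀ F Z Rx Rv Q R) {p : E × E}
    (hp : p ∈ closedBall (0 : E) Rx ×ˢ closedBall (0 : E) Rv) {s t : ℝ} (hs : s ∈ Icc 0 T)
    (ht : t ∈ Icc 0 T) : dist (Z t p).1 (Z s p).1 ≤ R * |t - s| := by
  have := (convex_Icc 0 T).norm_image_sub_le_of_norm_hasDerivWithin_le (C := R)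
    (f := fun τ => (Z τ p).1) (h.pos p) (fun r hr => by simpa using (h.conf p hp r hr).2) hs ht
  rwa [dist_eq_norm]

theorem dist_vel_le (h : IsConfinedFlow k T μ₀ F Z Rx Rv Q R) (hk : IsCommKernel k K₁ K₀ L)
    {p : E × E} (hp : p ∈ closedBall (0 : E) Rx ×ˢ closedBall (0 : E) Rv) {s t : ℝ}
    (hs : s ∈ Icc 0 T) (ht : t ∈ Icc 0 T) :
    dist (Z t p).2 (Z s p).2 ≤ K₀ * (2 * R) * |t - s| := by
  have := (convex_Icc 0 T).norm_image_sub_le_of_norm_hasDerivWithin_le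
    (f := fun τ => (Z τ p).2) (h.vel p)
    (fun r hr => (h.isBoxMeasure hr).norm_topField_le hk _ _ (h.conf p hp r hr).2) hs ht
  rwa [dist_eq_norm]

theorem massBall_le_add (h : IsConfinedFlow k T μ₀ F Z Rx Rv Q R) {s t : ℝ} (hs : s ∈ Icc 0 T)
    (ht : t ∈ Icc 0 T) (x : E) (r : ℝ) :
    massBall (F t) x r ≤ massBall (F s) x (r + R * |t - s|) := by
  have := h.isProbabilityMeasure hs
  have hm : ∀ r : ℝ, MeasurableSet (closedBall x r ×ˢ univ : Set (E × E)) := fun r =>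
    isClosed_closedBall.measurableSet.prod MeasurableSet.univ
  refine ENNReal.toReal_mono (measure_ne_top _ _) ?_
  rw [← h.map_eq t ht, ← h.map_eq s hs, Measure.map_apply_of_aemeasurable (h.aemeasurable t ht)
    (hm _), Measure.map_apply_of_aemeasurable (h.aemeasurable s hs) (hm _)]
  refine measure_mono_ae ?_
  filter_upwards [h.init] with p hp hpt
  refine ⟨?_, mem_univ _⟩
  have h1 := h.dist_pos_le hp hs ht
  have h2 : dist (Z t p).1 x ≤ r := hpt.1
  have h3 := dist_triangle_left (Z s p).1 x (Z t p).1
  rw [mem_closedBall]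
  linarith

theorem mul_abs_sub_le (h : IsConfinedFlow k T μ₀ F Z Rx Rv Q R) {s t : ℝ} (hs : s ∈ Icc 0 T)
    (ht : t ∈ Icc 0 T) : R * |t - s| ≤ Q := by
  have h1 : |t - s| ≤ T := abs_sub_le_iff.2 ⟨by linarith [ht.2, hs.1], by linarith [hs.2, ht.1]⟩
  have h2 := mul_le_mul_of_nonneg_left h1 h.bound_nonneg
  linarith [h.pos_le, h.pos_nonneg]

theorem abs_massBall_sub_le [(volume : Measure E).IsAddHaarMeasure]
    (h : IsConfinedFlow k T μ₀ F Z Rx Rv Q R) (hB : 0 ≤ B)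
    (hF : ∀ t ∈ Icc 0 T, F t ≤ ENNReal.ofReal B • volume) {s t : ℝ} (hs : s ∈ Icc 0 T)
    (ht : t ∈ Icc 0 T) (x : E) {r : ℝ} (hr : 0 ≤ r) (hrQ : r ≤ 2 * Q) :
    |massBall (F t) x r - massBall (F s) x r| ≤ massLip E B Q R * (R * |t - s|) := by
  have key : ∀ {s t : ℝ}, s ∈ Icc 0 T → t ∈ Icc 0 T →
      massBall (F t) x r ≤ massBall (F s) x r + massLip E B Q R * (R * |t - s|) := by
    intro s t hs ht
    have h1 := h.mul_abs_sub_le hs ht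
    have h2 : 0 ≤ R * |t - s| := mul_nonneg h.bound_nonneg (abs_nonneg _)
    exact (h.massBall_le_add hs ht x r).trans
      (massBall_add_le hB (h.isBoxMeasure hs) (hF s hs) x hr h2 (by linarith))
  rw [abs_sub_le_iff]
  have h1 := key hs ht
  have h2 := key ht hs
  rw [abs_sub_comm s t] at h2
  constructor <;> linarith

theorem topField_eq_integral (h : IsConfinedFlow k T μ₀ F Z Rx Rv Q R)
    (hk : IsCommKernel k K₁ K₀ L) (μ : Measure (E × E)) [IsProbabilityMeasure μ] {t : ℝ}
    (ht : t ∈ Icc 0 T) (x v : E) : topField k μ (F t) x v =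
      ∫ p, k (massBall μ x (dist x (Z t p).1)) • ((Z t p).2 - v) ∂μ₀ := by
  have := ((h.isBoxMeasure ht).integrable_field hk μ x v).aestronglyMeasurable
  rw [← h.map_eq t ht] at this
  rw [topField, ← h.map_eq t ht, integral_map (h.aemeasurable t ht) this]

theorem integrable_comp (h : IsConfinedFlow k T μ₀ F Z Rx Rv Q R)
    (hk : IsCommKernel k K₁ K₀ L) (μ : Measure (E × E)) [IsProbabilityMeasure μ] {t : ℝ}
    (ht : t ∈ Icc 0 T) (x v : E) :
    Integrable (fun p => k (massBall μ x (dist x (Z t p).1)) • ((Z t p).2 - v)) μ₀ := by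
  have := (h.isBoxMeasure ht).integrable_field hk μ x v
  rw [← h.map_eq t ht] at this
  exact this.comp_aemeasurable (h.aemeasurable t ht)

/-- The self-consistent field is Lipschitz in time. -/
theorem norm_topField_sub_time_le [(volume : Measure E).IsAddHaarMeasure]
    (h : IsConfinedFlow k T μ₀ F Z Rx Rv Q R) (hk : IsCommKernel k K₁ K₀ L) (hB : 0 ≤ B)
    (hF : ∀ t ∈ Icc 0 T, F t ≤ ENNReal.ofReal B • volume) {s t : ℝ} (hs : s ∈ Icc 0 T)
    (ht : t ∈ Icc 0 T) {x v : E} (hx : x ∈ closedBall (0 : E) Q)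
    (hv : v ∈ closedBall (0 : E) R) :
    ‖topField k (F t) (F t) x v - topField k (F s) (F s) x v‖ ≤
      (2 * R * (L * massLip E B Q R) * (2 * R) + K₀ * (K₀ * (2 * R))) * |t - s| := by
  have := h.prob
  have := h.isProbabilityMeasure hs
  have := h.isProbabilityMeasure ht
  have hK := hk.upper_pos
  have hR := h.bound_nonneg
  have hM := massLip_nonneg (E := E) (R := R) hB (dist_nonneg.trans hx : (0:ℝ) ≤ Q)
  rw [h.topField_eq_integral hk _ ht, h.topField_eq_integral hk _ hs,
    ← integral_sub (h.integrable_comp hk _ ht x v) (h.integrable_comp hk _ hs x v)]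
  suffices ∀ᵐ p ∂μ₀, ‖k (massBall (F t) x (dist x (Z t p).1)) • ((Z t p).2 - v) -
      k (massBall (F s) x (dist x (Z s p).1)) • ((Z s p).2 - v)‖ ≤
      (2 * R * (L * massLip E B Q R) * (2 * R) + K₀ * (K₀ * (2 * R))) * |t - s| by
    simpa using norm_integral_le_of_norm_le_const this
  filter_upwards [h.init] with p hp
  have hpt := h.conf p hp t ht
  have hps := h.conf p hp s hs
  have h1 := norm_integrand_sub_le hk hB (h.isBoxMeasure hs) (hF s hs) hx hx hv hpt hps
    (v' := v)
  rw [dist_self, dist_self, mul_zero, zero_add, add_zero] at h1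
  have h2 : |k (massBall (F t) x (dist x (Z t p).1)) - k (massBall (F s) x (dist x (Z t p).1))| ≤
      L * (massLip E B Q R * (R * |t - s|)) := by
    have h3 := hk.lip.dist_le_mul (massBall (F t) x (dist x (Z t p).1))
      (massBall (F s) x (dist x (Z t p).1))
    rw [Real.dist_eq, Real.dist_eq] at h3
    refine h3.trans (mul_le_mul_of_nonneg_left ?_ L.2)
    exact h.abs_massBall_sub_le hB hF hs ht x dist_nonneg (dist_le_of_mem_closedBall_zero hx hpt.1)
  have h4 := dist_le_of_mem_closedBall_zero hpt.2 hv
  rw [dist_eq_norm] at h4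
  calc _ ≤ ‖k (massBall (F t) x (dist x (Z t p).1)) • ((Z t p).2 - v) -
        k (massBall (F s) x (dist x (Z t p).1)) • ((Z t p).2 - v)‖ +
        ‖k (massBall (F s) x (dist x (Z t p).1)) • ((Z t p).2 - v) -
        k (massBall (F s) x (dist x (Z s p).1)) • ((Z s p).2 - v)‖ := norm_sub_le_norm_sub_add_norm_sub _ _ _
    _ ≤ L * (massLip E B Q R * (R * |t - s|)) * (2 * R) +
        (2 * R * (L * massLip E B Q R) * (R * |t - s|) + K₀ * (K₀ * (2 * R) * |t - s|)) := by
        refine add_le_add ?_ (h1.trans ?_)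
        · rw [← sub_smul, norm_smul, Real.norm_eq_abs]
          exact mul_le_mul h2 h4 (norm_nonneg _) ((abs_nonneg _).trans h2)
        · have h5 := h.dist_pos_le hp hs ht
          have h6 := h.dist_vel_le hk hp hs ht
          gcongr
    _ = _ := by ring

end IsConfinedFlow

section Liouville

variable {E : Type*} [NormedAddCommGroup E] [InnerProductSpace ℝ E] [FiniteDimensional ℝ E]
  [MeasureSpace E] [BorelSpace E] {k : ℝ → ℝ} {K₁ K₀ T Rx Rv Q R B : ℝ} {L : NNReal}
  {μ₀ : Measure (E × E)} {F : ℝ → Measure (E × E)} {Z : ℝ → E × E → E × E}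

/-- Iterates of the splitting scheme with time step `h`. -/
def eulerIter (k : ℝ → ℝ) (F : ℝ → Measure (E × E)) (h : ℝ) : ℕ → E × E → E × E
  | 0 => id
  | i + 1 => eulerStep k (F (i * h)) h ∘ eulerIter k F h i

namespace IsConfinedFlow

theorem volume_preimage_eulerIter_le [(volume : Measure E).IsAddHaarMeasure]
    (hf : IsConfinedFlow k T μ₀ F Z Rx Rv Q R) (hk : IsCommKernel k K₁ K₀ L) {h : ℝ} (hh : 0 ≤ h)
    (hhK : h * K₀ ≤ 1 / 2) (i : ℕ) (hi : i * h ≤ T) {U : Set (E × E)} (hU : MeasurableSet U) :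
    (volume : Measure (E × E)) (eulerIter k F h i ⁻¹' U) ≤
      ENNReal.ofReal (Real.exp (2 * (h * K₀)) ^ Module.finrank ℝ E) ^ i * volume U := by
  induction i generalizing U with
  | zero => simp [eulerIter]
  | succ i ih =>
    push_cast at hi
    have hi' : (i : ℝ) * h ≤ T := by linarith
    have hm : (i : ℝ) * h ∈ Icc 0 T := ⟨by positivity, hi'⟩
    have := hf.isProbabilityMeasure hm
    rw [eulerIter, preimage_comp, pow_succ, mul_assoc]
    refine (ih hi' (measurable_eulerStep hk _ h hU)).trans ?_
    gcongr
    exact volume_preimage_eulerStep_le hk (hf.isBoxMeasure hm) hh hhK hU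

theorem eulerIter_mem (hf : IsConfinedFlow k T μ₀ F Z Rx Rv Q R)
    (hk : IsCommKernel k K₁ K₀ L) {h : ℝ} (hh : 0 ≤ h) (hhK : h * K₀ ≤ 1 / 2) (i : ℕ)
    (hi : i * h ≤ T) {p : E × E} (hp : p ∈ closedBall (0 : E) Rx ×ˢ closedBall (0 : E) Rv) :
    ‖(eulerIter k F h i p).1‖ ≤ Rx + i * h * R ∧
      (eulerIter k F h i p).2 ∈ closedBall (0 : E) R := by
  induction i with
  | zero =>
    simp only [eulerIter, id, Nat.cast_zero, zero_mul, add_zero]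
    exact ⟨by simpa using hp.1, closedBall_subset_closedBall hf.vel_le hp.2⟩
  | succ i ih =>
    push_cast at hi ⊢
    have hi' : (i : ℝ) * h ≤ T := by linarith
    have hm : (i : ℝ) * h ∈ Icc 0 T := ⟨by positivity, hi'⟩
    obtain ⟨h1, h2⟩ := ih hi'
    have := hf.isProbabilityMeasure hm
    refine ⟨?_, (hf.isBoxMeasure hm).add_smul_topField_mem hk _ _ h2 hh (by linarith)⟩
    change ‖(eulerIter k F h i p).1 + h • (eulerIter k F h i p).2‖ ≤ _
    have h3 : ‖(eulerIter k F h i p).2‖ ≤ R := by simpa using h2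
    calc _ ≤ (Rx + i * h * R) + h * R := by
          refine (norm_add_le _ _).trans (add_le_add h1 ?_)
          rw [norm_smul, Real.norm_of_nonneg hh]
          gcongr
      _ = _ := by ring

theorem eulerIter_mem_box (hf : IsConfinedFlow k T μ₀ F Z Rx Rv Q R)
    (hk : IsCommKernel k K₁ K₀ L) {h : ℝ} (hh : 0 ≤ h) (hhK : h * K₀ ≤ 1 / 2) (i : ℕ)
    (hi : i * h ≤ T) {p : E × E} (hp : p ∈ closedBall (0 : E) Rx ×ˢ closedBall (0 : E) Rv) :
    eulerIter k F h i p ∈ closedBall (0 : E) Q ×ˢ closedBall (0 : E) R := by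
  obtain ⟨h1, h2⟩ := hf.eulerIter_mem hk hh hhK i hi hp
  refine ⟨?_, h2⟩
  have := mul_le_mul_of_nonneg_right hi hf.bound_nonneg
  rw [mem_closedBall_zero_iff]
  linarith [hf.pos_le]

/-- Local error of the splitting scheme. -/
theorem dist_eulerStep_le [(volume : Measure E).IsAddHaarMeasure]
    (hf : IsConfinedFlow k T μ₀ F Z Rx Rv Q R) (hk : IsCommKernel k K₁ K₀ L) (hB : 0 ≤ B)
    (hF : ∀ t ∈ Icc 0 T, F t ≤ ENNReal.ofReal B • volume) :
    ∃ A C : ℝ, 0 ≤ A ∧ 0 ≤ C ∧ ∀ s h : ℝ, 0 ≤ s → 0 ≤ h → s + h ≤ T →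
      ∀ p ∈ closedBall (0 : E) Rx ×ˢ closedBall (0 : E) Rv,
      ∀ q ∈ closedBall (0 : E) Q ×ˢ closedBall (0 : E) R, q.1 + h • q.2 ∈ closedBall (0 : E) Q →
      dist (eulerStep k (F s) h q) (Z (s + h) p) ≤ (1 + A * h) * dist q (Z s p) + C * h ^ 2 := by
  set Λ := fieldLip E L K₀ B Q R with hΛ
  set M := 2 * R * (L * massLip E B Q R) * (2 * R) + K₀ * (K₀ * (2 * R)) with hM
  have hK := hk.upper_pos
  have hR := hf.bound_nonneg
  by_cases hT : 0 ≤ T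
  swap
  · exact ⟨0, 0, le_rfl, le_rfl, fun s h hs hh hsh => absurd (by linarith) hT⟩
  have hQ : 0 ≤ Q := by
    have := mul_nonneg hR hT
    linarith [hf.pos_le, hf.pos_nonneg]
  have hmass := massLip_nonneg (E := E) (R := R) hB hQ
  have hΛ0 : 0 ≤ Λ := by rw [hΛ, fieldLip]; positivity
  have hM0 : 0 ≤ M := by positivity
  refine ⟨1 + Λ, K₀ * (2 * R) + (Λ * R + (M + Λ * (R + K₀ * (2 * R)))), by positivity,
    by positivity, fun s h hs hh hsh p hp q hq hq' => ?_⟩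
  have hsm : s ∈ Icc 0 T := ⟨hs, by linarith⟩
  have htm : s + h ∈ Icc 0 T := ⟨by linarith, hsh⟩
  have hsub : Icc s (s + h) ⊆ Icc 0 T := Icc_subset_Icc hs hsh
  have := hf.isProbabilityMeasure hsm
  have habs : ∀ τ ∈ Icc s (s + h), |τ - s| ≤ h := fun τ hτ => by
    rw [abs_of_nonneg (by linarith [hτ.1])]; linarith [hτ.2]
  set e := dist q (Z s p) with he
  have he1 : ‖q.1 - (Z s p).1‖ ≤ e := by rw [← dist_eq_norm]; exact le_max_left _ _
  have he2 : ‖q.2 - (Z s p).2‖ ≤ e := by rw [← dist_eq_norm]; exact le_max_right _ _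
  have hqR : ‖q.2‖ ≤ R := by simpa using hq.2
  have hpos := norm_sub_sub_smul_le (c := (Z s p).2) (M := K₀ * (2 * R) * h)
    (by linarith : s ≤ s + h) (fun τ hτ => (hf.pos p τ (hsub hτ)).mono hsub) fun τ hτ => by
      rw [← dist_eq_norm]
      refine (hf.dist_vel_le hk hp hsm (hsub hτ)).trans ?_
      gcongr
      exact habs τ hτ
  have hvel := norm_sub_sub_smul_le (c := topField k (F s) (F s) (Z s p).1 (Z s p).2)
    (M := (M + Λ * (R + K₀ * (2 * R))) * h)
    (by linarith : s ≤ s + h) (fun τ hτ => (hf.vel p τ (hsub hτ)).mono hsub) fun τ hτ => by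
      have hz := hf.conf p hp τ (hsub hτ)
      have h1 := hf.norm_topField_sub_time_le hk hB hF hsm (hsub hτ) hz.1 hz.2
      have h2 := norm_topField_sub_le hk hB (hf.isBoxMeasure hsm) (hF s hsm)
        (hf.isBoxMeasure hsm) hz (hf.conf p hp s hsm)
      have h3 : dist (Z τ p) (Z s p) ≤ (R + K₀ * (2 * R)) * h := by
        have hd1 := hf.dist_pos_le hp hsm (hsub hτ)
        have hd2 := hf.dist_vel_le hk hp hsm (hsub hτ)
        have h4 := habs τ hτ
        refine max_le (hd1.trans ?_) (hd2.trans ?_)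
        · gcongr; exact le_add_of_nonneg_right (by positivity)
        · gcongr; exact le_add_of_nonneg_left hR
      calc _ ≤ ‖topField k (F τ) (F τ) (Z τ p).1 (Z τ p).2 -
            topField k (F s) (F s) (Z τ p).1 (Z τ p).2‖ +
            ‖topField k (F s) (F s) (Z τ p).1 (Z τ p).2 -
            topField k (F s) (F s) (Z s p).1 (Z s p).2‖ := norm_sub_le_norm_sub_add_norm_sub _ _ _
        _ ≤ M * h + Λ * ((R + K₀ * (2 * R)) * h) := by
            refine add_le_add (h1.trans ?_) (h2.trans ?_)
            · gcongr; exact habs τ hτ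
            · gcongr
        _ = _ := by ring
  rw [add_sub_cancel_left] at hpos hvel
  have hkick : ‖topField k (F s) (F s) (q.1 + h • q.2) q.2 -
      topField k (F s) (F s) (Z s p).1 (Z s p).2‖ ≤ Λ * (e + h * R) := by
    have h2 := norm_topField_sub_le hk hB (hf.isBoxMeasure hsm) (hF s hsm)
        (hf.isBoxMeasure hsm) (q := (q.1 + h • q.2, q.2)) ⟨hq', hq.2⟩ (hf.conf p hp s hsm)
    refine h2.trans (mul_le_mul_of_nonneg_left (max_le ?_ ?_) hΛ0)
    · rw [dist_eq_norm, show (q.1 + h • q.2, q.2).1 - (Z s p).1 =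
        (q.1 - (Z s p).1) + h • q.2 by simp only; abel]
      refine (norm_add_le _ _).trans (add_le_add he1 ?_)
      rw [norm_smul, Real.norm_of_nonneg hh]
      gcongr
    · rw [dist_eq_norm]
      exact he2.trans (le_add_of_nonneg_right (by positivity))
  have he0 : 0 ≤ e := dist_nonneg
  refine max_le ?_ ?_
  · rw [dist_eq_norm]
    calc ‖q.1 + h • q.2 - (Z (s + h) p).1‖ = ‖(q.1 - (Z s p).1) + h • (q.2 - (Z s p).2) -
          ((Z (s + h) p).1 - (Z s p).1 - h • (Z s p).2)‖ := by
          congr 1; rw [smul_sub]; abel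
      _ ≤ (e + h * e) + K₀ * (2 * R) * h * h := by
          refine (norm_sub_le _ _).trans (add_le_add ((norm_add_le _ _).trans
            (add_le_add he1 ?_)) hpos)
          rw [norm_smul, Real.norm_of_nonneg hh]
          gcongr
      _ ≤ _ := by
          have h1 : 0 ≤ Λ * h * e := by positivity
          have h2 : 0 ≤ (Λ * R + (M + Λ * (R + K₀ * (2 * R)))) * h ^ 2 := by positivity
          nlinarith
  · rw [dist_eq_norm]
    calc ‖q.2 + h • topField k (F s) (F s) (q.1 + h • q.2) q.2 - (Z (s + h) p).2‖ =
          ‖(q.2 - (Z s p).2) + h • (topField k (F s) (F s) (q.1 + h • q.2) q.2 -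
            topField k (F s) (F s) (Z s p).1 (Z s p).2) -
          ((Z (s + h) p).2 - (Z s p).2 - h • topField k (F s) (F s) (Z s p).1 (Z s p).2)‖ := by
          congr 1; rw [smul_sub]; abel
      _ ≤ (e + h * (Λ * (e + h * R))) + (M + Λ * (R + K₀ * (2 * R))) * h * h := by
          refine (norm_sub_le _ _).trans (add_le_add ((norm_add_le _ _).trans
            (add_le_add he2 ?_)) hvel)
          rw [norm_smul, Real.norm_of_nonneg hh]
          gcongr
      _ ≤ _ := by
          have h1 : 0 ≤ h * e := by positivity
          have h2 : 0 ≤ K₀ * (2 * R) * h ^ 2 := by positivity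
          nlinarith

/-- The splitting scheme converges to the flow. -/
theorem tendsto_eulerIter [(volume : Measure E).IsAddHaarMeasure]
    (hf : IsConfinedFlow k T μ₀ F Z Rx Rv Q R) (hk : IsCommKernel k K₁ K₀ L) (hB : 0 ≤ B)
    (hF : ∀ t ∈ Icc 0 T, F t ≤ ENNReal.ofReal B • volume) {t : ℝ} (ht : t ∈ Icc 0 T) {p : E × E}
    (hp : p ∈ closedBall (0 : E) Rx ×ˢ closedBall (0 : E) Rv) :
    Filter.Tendsto (fun j : ℕ => eulerIter k F (t / j) j p) Filter.atTop (nhds (Z t p)) := by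
  obtain ⟨A, C, hA, hC, hstep⟩ := hf.dist_eulerStep_le hk hB hF
  have hK := hk.upper_pos
  have ht0 := ht.1
  rw [tendsto_iff_dist_tendsto_zero]
  have hlim : Filter.Tendsto (fun j : ℕ => C * t ^ 2 * Real.exp (A * t) / j) Filter.atTop
    (nhds 0) := tendsto_const_div_atTop_nhds_zero_nat _
  refine squeeze_zero' (Filter.Eventually.of_forall fun _ => dist_nonneg) ?_ hlim
  filter_upwards [Filter.eventually_ge_atTop (max 1 ⌈2 * t * K₀⌉₊)] with j hj
  have hj1 : 1 ≤ j := (le_max_left _ _).trans hj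
  have hj2 : 2 * t * K₀ ≤ j := Nat.ceil_le.1 ((le_max_right _ _).trans hj)
  have hj0 : (0 : ℝ) < j := by exact_mod_cast hj1
  set h := t / j with hh
  have hh0 : 0 ≤ h := by positivity
  have hjh : j * h = t := by rw [hh]; field_simp
  have hhK : h * K₀ ≤ 1 / 2 := by
    rw [hh, div_mul_eq_mul_div, div_le_iff₀ hj0]; linarith
  have hle : ∀ i ≤ j, i * h ≤ T := fun i hi => by
    have : (i : ℝ) * h ≤ j * h := by gcongr
    linarith [ht.2]
  have := discrete_gronwall_of_step (e := fun i => dist (eulerIter k F h i p) (Z (i * h) p))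
    (n := j) (A := A * h) (c := C * h ^ 2) (by positivity) (by positivity)
    (by simp [eulerIter, hf.zero]) (fun i hi => by
      have h1 := hle (i + 1) hi
      have h2 := hle i hi.le
      have hmem := (hf.eulerIter_mem_box hk hh0 hhK (i + 1) h1 hp).1
      push_cast at h1 ⊢
      rw [add_mul, one_mul] at h1 ⊢
      exact hstep _ h (by positivity) hh0 h1 p hp _ (hf.eulerIter_mem_box hk hh0 hhK i h2 hp) hmem)
    j le_rfl
  simp only [hjh] at this
  refine this.trans ?_
  have hexp : (1 + A * h) ^ j ≤ Real.exp (A * t) := by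
    rw [show A * t = j * (A * h) by rw [← hjh]; ring, Real.exp_nat_mul]
    gcongr
    linarith [Real.add_one_le_exp (A * h)]
  calc _ ≤ j * (C * h ^ 2) * Real.exp (A * t) := by gcongr
    _ = _ := by rw [hh]; field_simp

/-- Liouville estimate: the density of the flow grows at most exponentially, at a rate depending
only on the kernel and the dimension. -/
theorem le_smul_volume [(volume : Measure E).IsAddHaarMeasure]
    (hf : IsConfinedFlow k T μ₀ F Z Rx Rv Q R) (hk : IsCommKernel k K₁ K₀ L) {C : ℝ} (hC : 0 ≤ C)
    (hF : ∀ t ∈ Icc 0 T, F t ≤ ENNReal.ofReal C • volume) (hB : 0 ≤ B)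
    (hμ₀ : μ₀ ≤ ENNReal.ofReal B • volume) {t : ℝ} (ht : t ∈ Icc 0 T) :
    F t ≤ ENNReal.ofReal (B * Real.exp (2 * (T * K₀)) ^ Module.finrank ℝ E) • volume := by
  set c := B * Real.exp (2 * (T * K₀)) ^ Module.finrank ℝ E with hc
  have hK := hk.upper_pos
  have ht0 := ht.1
  have hopen : ∀ U : Set (E × E), IsOpen U → F t U ≤ (ENNReal.ofReal c • volume) U := by
    intro U hU
    rw [← hf.map_eq t ht, Measure.map_apply_of_aemeasurable (hf.aemeasurable t ht) hU.measurableSet]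
    have h1 : μ₀ (Z t ⁻¹' U) ≤
        μ₀ (Z t ⁻¹' U ∩ (closedBall (0 : E) Rx ×ˢ closedBall (0 : E) Rv)) := by
      refine measure_mono_ae ?_
      filter_upwards [hf.init] with p hp hpU using ⟨hpU, hp⟩
    refine h1.trans ?_
    set j₀ := max 1 ⌈2 * t * K₀⌉₊ with hj₀
    refine measure_le_of_eventually_mem
      (A := fun j => eulerIter k F (t / (j + j₀ : ℕ)) (j + j₀) ⁻¹' U) ?_ fun j => ?_
    · rintro p ⟨hpU, hp⟩
      have := (hf.tendsto_eulerIter hk hC hF ht hp).comp (Filter.tendsto_add_atTop_nat j₀)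
      exact this.eventually (hU.mem_nhds hpU)
    · have hj1 : 1 ≤ j + j₀ := by have := le_max_left 1 ⌈2 * t * K₀⌉₊; omega
      have hj2 : 2 * t * K₀ ≤ (j + j₀ : ℕ) :=
        Nat.ceil_le.1 ((le_max_right _ _).trans (Nat.le_add_left _ _))
      set n := j + j₀
      have hn0 : (0 : ℝ) < n := by exact_mod_cast hj1
      have hjh : n * (t / n) = t := by field_simp
      have hhK : t / n * K₀ ≤ 1 / 2 := by
        rw [div_mul_eq_mul_div, div_le_iff₀ hn0]; linarith
      refine (hμ₀ _).trans ?_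
      rw [Measure.smul_apply, Measure.smul_apply, smul_eq_mul, smul_eq_mul]
      have h2 := hf.volume_preimage_eulerIter_le hk (by positivity) hhK n (by rw [hjh]; exact ht.2)
        hU.measurableSet
      rw [← ENNReal.ofReal_pow (by positivity), ← pow_mul, mul_comm _ n, pow_mul,
        ← Real.exp_nat_mul,
        show (n : ℝ) * (2 * (t / n * K₀)) = 2 * (n * (t / n) * K₀) by ring, hjh] at h2
      rw [hc, ENNReal.ofReal_mul hB, mul_assoc]
      gcongr
      refine h2.trans ?_
      gcongr
      exact ht.2
  refine Measure.le_iff'.2 fun s => ?_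
  have : (ENNReal.ofReal c • (volume : Measure (E × E))).OuterRegular :=
    Measure.OuterRegular.smul _ ENNReal.ofReal_ne_top
  rw [s.measure_eq_iInf_isOpen (ENNReal.ofReal c • volume)]
  exact le_iInf₂ fun U hsU => le_iInf fun hU => (measure_mono hsU).trans (hopen U hU)

end IsConfinedFlow

end Liouville

section Wasserstein

variable {α : Type*} [MeasurableSpace α] [PseudoMetricSpace α] [OpensMeasurableSpace α]
  {μ ν : Measure α} {S : Set α}

theorem integrable_of_bounded_of_lipschitz [IsFiniteMeasure μ] {φ : α → ℝ} {c : NNReal}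
    (hφ : LipschitzWith c φ) (hb : ∃ C : ℝ, ∀ x, |φ x| ≤ C) : Integrable φ μ := by
  obtain ⟨C, hC⟩ := hb
  exact Integrable.of_bound hφ.continuous.measurable.aestronglyMeasurable C (ae_of_all _ hC)

theorem bddAbove_W1 [IsProbabilityMeasure μ] [IsProbabilityMeasure ν]
    (hS : Bornology.IsBounded S) (hμ : ∀ᵐ x ∂μ, x ∈ S) (hν : ∀ᵐ x ∂ν, x ∈ S) :
    BddAbove {a : ℝ | ∃ φ : α → ℝ, LipschitzWith 1 φ ∧ (∃ C : ℝ, ∀ x, |φ x| ≤ C) ∧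
      a = (∫ x, φ x ∂μ) - ∫ x, φ x ∂ν} := by
  obtain ⟨x₀, hx₀⟩ := hμ.exists
  obtain ⟨D, hD⟩ := hS.subset_closedBall x₀
  have key : ∀ (m : Measure α) [IsProbabilityMeasure m], (∀ᵐ x ∂m, x ∈ S) → ∀ φ : α → ℝ,
      LipschitzWith 1 φ → (∃ C : ℝ, ∀ x, |φ x| ≤ C) → |(∫ x, φ x ∂m) - φ x₀| ≤ D := by
    intro m _ hm φ hφ hb
    have hi := integrable_of_bounded_of_lipschitz (μ := m) hφ hb
    have h1 : (∫ x, φ x ∂m) - φ x₀ = ∫ x, (φ x - φ x₀) ∂m := by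
      rw [integral_sub hi (integrable_const _)]; simp
    rw [h1, ← Real.norm_eq_abs]
    have h2 : ∀ᵐ x ∂m, ‖φ x - φ x₀‖ ≤ D := by
      filter_upwards [hm] with x hx
      have h3 := hφ.dist_le_mul x x₀
      have h4 := hD hx
      rw [mem_closedBall] at h4
      rw [NNReal.coe_one, one_mul, dist_eq_norm] at h3
      linarith
    simpa using norm_integral_le_of_norm_le_const h2
  refine ⟨D + D, ?_⟩
  rintro a ⟨φ, hφ, hb, rfl⟩
  have h1 := abs_le.1 (key μ hμ φ hφ hb)
  have h2 := abs_le.1 (key ν hν φ hφ hb)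
  linarith

/-- For boundedly supported measures, the duality bound holds for test functions which are only
Lipschitz on the support. -/
theorem abs_integral_sub_le_W1 [IsProbabilityMeasure μ] [IsProbabilityMeasure ν]
    (hS : Bornology.IsBounded S) (hμ : ∀ᵐ x ∂μ, x ∈ S) (hν : ∀ᵐ x ∂ν, x ∈ S) {g : α → ℝ} {c : ℝ}
    (hc : 0 < c) (hg : ∀ x ∈ S, ∀ y ∈ S, |g x - g y| ≤ c * dist x y) :
    |(∫ x, g x ∂μ) - ∫ x, g x ∂ν| ≤ c * W1 μ ν := by
  obtain ⟨φ, hφ, hφg⟩ := (LipschitzOnWith.of_dist_le_mul (f := fun x => c⁻¹ * g x) (K := 1)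
    (s := S) fun x hx y hy => by
      rw [Real.dist_eq, ← mul_sub, abs_mul, abs_of_pos (inv_pos.2 hc), NNReal.coe_one, one_mul,
        inv_mul_le_iff₀ hc]
      exact hg x hx y hy).extend_real
  obtain ⟨M, hM⟩ := (hφ.isBounded_image hS).subset_closedBall 0
  have hM' : ∀ x ∈ S, |φ x| ≤ M := fun x hx => by
    simpa using hM (mem_image_of_mem φ hx)
  set ψ : α → ℝ := fun x => max (-M) (min (φ x) M) with hψ
  have hψL : LipschitzWith 1 ψ := (hφ.min_const M).const_max (-M)
  have hM0 : 0 ≤ M := by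
    obtain ⟨x₀, hx₀⟩ := hμ.exists
    exact (abs_nonneg _).trans (hM' x₀ hx₀)
  have hψb : ∀ x, |ψ x| ≤ M := fun x =>
    abs_le.2 ⟨le_max_left _ _, max_le (by linarith) (min_le_right _ _)⟩
  have hψg : ∀ x ∈ S, g x = c * ψ x := fun x hx => by
    have h1 := abs_le.1 (hM' x hx)
    have h2 : φ x = c⁻¹ * g x := (hφg hx).symm
    simp only [hψ]
    rw [min_eq_left h1.2, max_eq_right h1.1, h2, mul_inv_cancel_left₀ hc.ne']
  have hint : ∀ m : Measure α, (∀ᵐ x ∂m, x ∈ S) → ∫ x, g x ∂m = c * ∫ x, ψ x ∂m := by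
    intro m hm
    rw [← integral_const_mul]
    refine integral_congr_ae ?_
    filter_upwards [hm] with x hx using hψg x hx
  have hbdd := bddAbove_W1 hS hμ hν
  rw [hint μ hμ, hint ν hν, ← mul_sub, abs_mul, abs_of_pos hc]
  refine mul_le_mul_of_nonneg_left (abs_le.2 ⟨?_, ?_⟩) hc.le
  · have : (∫ x, -ψ x ∂μ) - ∫ x, -ψ x ∂ν ≤ W1 μ ν :=
      le_csSup hbdd ⟨fun x => -ψ x, hψL.neg, ⟨M, fun x => by rw [abs_neg]; exact hψb x⟩, rfl⟩
    rw [integral_neg, integral_neg] at this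
    linarith
  · exact le_csSup hbdd ⟨ψ, hψL, ⟨M, hψb⟩, rfl⟩

theorem W1_nonneg [IsProbabilityMeasure μ] [IsProbabilityMeasure ν]
    (hS : Bornology.IsBounded S) (hμ : ∀ᵐ x ∂μ, x ∈ S) (hν : ∀ᵐ x ∂ν, x ∈ S) : 0 ≤ W1 μ ν := by
  simpa using abs_integral_sub_le_W1 hS hμ hν (g := fun _ => 0) one_pos (by simp)

end Wasserstein

section Empirical

variable {α : Type*} [MeasurableSpace α] {N : ℕ}

/-- The uniform probability measure on the entries of a finite family. -/
def empMeasure (z : Fin N → α) : Measure α := ((N : ℝ≥0∞))⁻¹ • ∑ i : Fin N, Measure.dirac (z i)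

theorem isProbabilityMeasure_empMeasure (hN : 0 < N) (z : Fin N → α) :
    IsProbabilityMeasure (empMeasure z) := ⟨by
  simp only [empMeasure, Measure.smul_apply, Measure.finsetSum_apply, measure_univ, Finset.sum_const,
    Finset.card_univ, Fintype.card_fin, nsmul_eq_mul, mul_one, smul_eq_mul]
  exact ENNReal.inv_mul_cancel (by exact_mod_cast hN.ne') (ENNReal.natCast_ne_top N)⟩

variable [MeasurableSingletonClass α]

theorem ae_empMeasure {z : Fin N → α} {P : α → Prop} (h : ∀ i, P (z i)) :
    ∀ᵐ p ∂empMeasure z, P p := by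
  refine Measure.ae_smul_measure ?_ _
  rw [ae_finsetSum_measure_iff]
  intro i _
  rw [ae_dirac_eq]
  exact h i

theorem integral_empMeasure {G : Type*} [NormedAddCommGroup G] [NormedSpace ℝ G] [CompleteSpace G]
    (z : Fin N → α) (g : α → G) :
    ∫ p, g p ∂empMeasure z = (N : ℝ)⁻¹ • ∑ i, g (z i) := by
  rw [empMeasure, integral_smul_measure, integral_finsetSum_measure
    fun i _ => (integrable_dirac (by finiteness))]
  simp [integral_dirac]

end Empirical

section Comparison

variable {E : Type*} [NormedAddCommGroup E] [InnerProductSpace ℝ E] [FiniteDimensional ℝ E]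
  [MeasureSpace E] [BorelSpace E] {k : ℝ → ℝ} {K₁ K₀ T Rx Rv Q R B : ℝ} {L : NNReal}
  {μ₀ : Measure (E × E)} {F : ℝ → Measure (E × E)} {Z : ℝ → E × E → E × E} {N : ℕ}

/-- Particles driven by the field of their own empirical measure, with the topological weights
computed from an external mass distribution. -/
structure IsParticleSystem (k : ℝ → ℝ) (T : ℝ) (F : ℝ → Measure (E × E))
    (z : ℝ → Fin N → E × E) : Prop where
  pos : ∀ t ∈ Icc 0 T, ∀ i, HasDerivWithinAt (fun τ => (z τ i).1) (z t i).2 (Icc 0 T) t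
  vel : ∀ t ∈ Icc 0 T, ∀ i, HasDerivWithinAt (fun τ => (z τ i).2)
    (topField k (F t) (empMeasure (z t)) (z t i).1 (z t i).2) (Icc 0 T) t

theorem IsParticleSystem.mem_box {z : ℝ → Fin N → E × E} (hz : IsParticleSystem k T F z)
    (hk : IsCommKernel k K₁ K₀ L) (hN : 0 < N) (hRv : 0 ≤ Rv)
    (h0 : ∀ i, z 0 i ∈ closedBall (0 : E) Rx ×ˢ closedBall (0 : E) Rv)
    (hR : gronwallBound Rv (2 * K₀) 0 T ≤ R) (hQ : Rx + R * T ≤ Q) {t : ℝ} (ht : t ∈ Icc 0 T)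
    (i : Fin N) : z t i ∈ closedBall (0 : E) Q ×ˢ closedBall (0 : E) R := by
  have hK := hk.upper_pos
  have hvel : ∀ t ∈ Icc 0 T, ∀ i, ‖(z t i).2‖ ≤ R := by
    intro t ht i
    have := norm_le_gronwallBound_Icc (g := fun τ i => (z τ i).2) (T := T) (δ := Rv) (A := 2 * K₀)
      (ε := 0) (by positivity) hRv le_rfl
      (fun t ht => hasDerivWithinAt_pi.2 fun i => hz.vel t ht i)
      ((pi_norm_le_iff_of_nonneg hRv).2 fun i => by simpa using (h0 i).2)
      (fun t _ => (pi_norm_le_iff_of_nonneg (by positivity)).2 fun i => ?_) ht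
    · exact ((norm_le_pi_norm (fun i => (z t i).2) i).trans this).trans hR
    · have := isProbabilityMeasure_empMeasure hN (z t)
      have hb : ∀ᵐ p ∂empMeasure (z t), ‖k (massBall (F t) (z t i).1 (dist (z t i).1 p.1)) •
          (p.2 - (z t i).2)‖ ≤ K₀ * (2 * ‖fun i => (z t i).2‖) := by
        refine ae_empMeasure fun j => ?_
        rw [norm_smul]
        have h1 := norm_sub_le (z t j).2 (z t i).2
        have h2 := norm_le_pi_norm (fun i => (z t i).2) j
        have h3 := norm_le_pi_norm (fun i => (z t i).2) i
        gcongr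
        · exact hk.abs_le _
        · linarith
      have := norm_integral_le_of_norm_le_const hb
      rw [probReal_univ, mul_one] at this
      refine this.trans_eq ?_
      ring
  refine ⟨?_, by simpa using hvel t ht i⟩
  have h0m : (0 : ℝ) ∈ Icc 0 T := ⟨le_rfl, ht.1.trans ht.2⟩
  have h1 := (convex_Icc 0 T).norm_image_sub_le_of_norm_hasDerivWithin_le
    (f := fun τ => (z τ i).1) (fun t ht => hz.pos t ht i) (fun t ht => hvel t ht i) h0m ht
  simp only [sub_zero, Real.norm_eq_abs, abs_of_nonneg ht.1] at h1
  have h2 := norm_sub_norm_le (z t i).1 (z 0 i).1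
  have h3 : ‖(z 0 i).1‖ ≤ Rx := by simpa using (h0 i).1
  have hR0 : 0 ≤ R := (norm_nonneg _).trans (hvel t ht i)
  have h4 : R * t ≤ R * T := by gcongr; exact ht.2
  rw [mem_closedBall_zero_iff]
  linarith

namespace IsConfinedFlow

variable [(volume : Measure E).IsAddHaarMeasure]

/-- The flow is Lipschitz in its initial condition. -/
theorem dist_flow_le (hf : IsConfinedFlow k T μ₀ F Z Rx Rv Q R) (hk : IsCommKernel k K₁ K₀ L)
    (hB : 0 ≤ B) (hF : ∀ t ∈ Icc 0 T, F t ≤ ENNReal.ofReal B • volume) {t : ℝ} (ht : t ∈ Icc 0 T)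
    {p q : E × E} (hp : p ∈ closedBall (0 : E) Rx ×ˢ closedBall (0 : E) Rv)
    (hq : q ∈ closedBall (0 : E) Rx ×ˢ closedBall (0 : E) Rv) :
    dist (Z t p) (Z t q) ≤ Real.exp ((1 + fieldLip E L K₀ B Q R) * T) * dist p q := by
  have hK := hk.upper_pos
  have hR := hf.bound_nonneg
  have hmass := massLip_nonneg (E := E) (R := R) hB (dist_nonneg.trans (hf.conf p hp t ht).1)
  have hΛ : 0 ≤ fieldLip E L K₀ B Q R := by unfold fieldLip; positivity
  have := norm_le_gronwallBound_Icc (g := fun τ => Z τ p - Z τ q) (T := T) (δ := dist p q)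
    (A := 1 + fieldLip E L K₀ B Q R) (ε := 0) (by positivity) dist_nonneg le_rfl
    (fun s hs => ((hf.pos p s hs).prodMk (hf.vel p s hs)).sub
      ((hf.pos q s hs).prodMk (hf.vel q s hs)))
    (by simp only [hf.zero, dist_eq_norm, le_refl]) (fun s hs => ?_) ht
  · rw [gronwallBound_ε0, mul_comm, ← dist_eq_norm] at this
    exact this
  · have h1 := norm_topField_sub_le hk hB (hf.isBoxMeasure hs) (hF s hs) (hf.isBoxMeasure hs)
      (hf.conf p hp s hs) (hf.conf q hq s hs)
    have h2 : ‖(Z s p).2 - (Z s q).2‖ ≤ ‖Z s p - Z s q‖ := norm_snd_le (Z s p - Z s q)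
    rw [dist_eq_norm] at h1
    have h3 : 0 ≤ fieldLip E L K₀ B Q R * ‖Z s p - Z s q‖ := by positivity
    refine max_le ?_ ?_
    · change ‖(Z s p).2 - (Z s q).2‖ ≤ _
      linarith
    · refine h1.trans ?_
      have := norm_nonneg (Z s p - Z s q)
      linarith

theorem abs_integral_sub_empMeasure_le (hf : IsConfinedFlow k T μ₀ F Z Rx Rv Q R)
    (hk : IsCommKernel k K₁ K₀ L) (hB : 0 ≤ B)
    (hF : ∀ t ∈ Icc 0 T, F t ≤ ENNReal.ofReal B • volume) {t : ℝ} (ht : t ∈ Icc 0 T)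
    (hN : 0 < N) {w z : Fin N → E × E}
    (hw : ∀ i, w i ∈ closedBall (0 : E) Rx ×ˢ closedBall (0 : E) Rv)
    (hz : ∀ i, z i ∈ closedBall (0 : E) Q ×ˢ closedBall (0 : E) R) {ψ : E × E → ℝ} {c : ℝ}
    (hc : 0 < c) (hψm : AEStronglyMeasurable ψ (F t))
    (hψ : ∀ p ∈ closedBall (0 : E) Q ×ˢ closedBall (0 : E) R,
      ∀ q ∈ closedBall (0 : E) Q ×ˢ closedBall (0 : E) R, |ψ p - ψ q| ≤ c * dist p q) :
    |(∫ p, ψ p ∂F t) - ∫ p, ψ p ∂empMeasure z| ≤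
      c * (Real.exp ((1 + fieldLip E L K₀ B Q R) * T) * W1 μ₀ (empMeasure w) +
        ‖fun i => z i - Z t (w i)‖) := by
  have := hf.prob
  have := isProbabilityMeasure_empMeasure hN w
  have hbdd : Bornology.IsBounded (closedBall (0 : E) Rx ×ˢ closedBall (0 : E) Rv) :=
    isBounded_closedBall.prod isBounded_closedBall
  have h1 := abs_integral_sub_le_W1 (μ := μ₀) (ν := empMeasure w) (g := fun p => ψ (Z t p))
    (c := c * Real.exp ((1 + fieldLip E L K₀ B Q R) * T)) hbdd hf.init (ae_empMeasure hw)
    (by positivity) (fun p hp q hq => by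
      refine (hψ _ (hf.conf p hp t ht) _ (hf.conf q hq t ht)).trans ?_
      rw [mul_assoc]
      gcongr
      exact hf.dist_flow_le hk hB hF ht hp hq)
  have h2 : ∫ p, ψ p ∂F t = ∫ p, ψ (Z t p) ∂μ₀ := by
    rw [← hf.map_eq t ht] at hψm ⊢
    exact integral_map (hf.aemeasurable t ht) hψm
  have h3 : |(∫ p, ψ (Z t p) ∂empMeasure w) - ∫ p, ψ p ∂empMeasure z| ≤
      c * ‖fun i => z i - Z t (w i)‖ := by
    have hN' : (0 : ℝ) < N := by exact_mod_cast hN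
    rw [integral_empMeasure, integral_empMeasure, ← smul_sub, ← Finset.sum_sub_distrib, smul_eq_mul,
      abs_mul, abs_of_pos (inv_pos.2 hN'), inv_mul_le_iff₀ hN']
    refine (Finset.abs_sum_le_sum_abs _ _).trans ?_
    have : ∀ i ∈ Finset.univ, |ψ (Z t (w i)) - ψ (z i)| ≤ c * ‖fun i => z i - Z t (w i)‖ := by
      intro i _
      rw [abs_sub_comm]
      refine (hψ _ (hz i) _ (hf.conf _ (hw i) t ht)).trans ?_
      gcongr
      rw [dist_eq_norm]
      exact norm_le_pi_norm (fun i => z i - Z t (w i)) i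
    simpa using Finset.sum_le_card_nsmul _ _ _ this
  rw [h2]
  calc _ ≤ |(∫ p, ψ (Z t p) ∂μ₀) - ∫ p, ψ (Z t p) ∂empMeasure w| +
        |(∫ p, ψ (Z t p) ∂empMeasure w) - ∫ p, ψ p ∂empMeasure z| := abs_sub_le _ _ _
    _ ≤ _ := by
        refine (add_le_add h1 h3).trans_eq ?_
        ring

theorem norm_topField_sub_empMeasure_le (hf : IsConfinedFlow k T μ₀ F Z Rx Rv Q R)
    (hk : IsCommKernel k K₁ K₀ L) (hB : 0 ≤ B)
    (hF : ∀ t ∈ Icc 0 T, F t ≤ ENNReal.ofReal B • volume) {t : ℝ} (ht : t ∈ Icc 0 T)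
    (hN : 0 < N) {w z : Fin N → E × E}
    (hw : ∀ i, w i ∈ closedBall (0 : E) Rx ×ˢ closedBall (0 : E) Rv)
    (hz : ∀ i, z i ∈ closedBall (0 : E) Q ×ˢ closedBall (0 : E) R) {q : E × E}
    (hq : q ∈ closedBall (0 : E) Q ×ˢ closedBall (0 : E) R) :
    ‖topField k (F t) (empMeasure z) q.1 q.2 - topField k (F t) (F t) q.1 q.2‖ ≤
      fieldLip E L K₀ B Q R *
        (Real.exp ((1 + fieldLip E L K₀ B Q R) * T) * W1 μ₀ (empMeasure w) +
        ‖fun i => z i - Z t (w i)‖) := by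
  have := hf.isProbabilityMeasure ht
  have := isProbabilityMeasure_empMeasure hN z
  have hK := hk.upper_pos
  have hR := hf.bound_nonneg
  have hmass := massLip_nonneg (E := E) (R := R) hB (dist_nonneg.trans hq.1)
  have hΛ : 0 < fieldLip E L K₀ B Q R := by unfold fieldLip; positivity
  have hν : IsBoxMeasure (empMeasure z) Q R := ⟨this, ae_empMeasure hz⟩
  have hi₁ := (hf.isBoxMeasure ht).integrable_field hk (F t) q.1 q.2
  have hi₂ := hν.integrable_field hk (F t) q.1 q.2
  rw [norm_sub_rev]
  set u := topField k (F t) (F t) q.1 q.2 - topField k (F t) (empMeasure z) q.1 q.2 with hu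
  rcases eq_or_ne u 0 with hu0 | hu0
  · rw [hu0, norm_zero]
    have hbdd : Bornology.IsBounded (closedBall (0 : E) Rx ×ˢ closedBall (0 : E) Rv) :=
      isBounded_closedBall.prod isBounded_closedBall
    have := hf.prob
    have := isProbabilityMeasure_empMeasure hN w
    have := W1_nonneg hbdd hf.init (ae_empMeasure hw)
    positivity
  have hupos : 0 < ‖u‖ := norm_pos_iff.2 hu0
  have key := hf.abs_integral_sub_empMeasure_le hk hB hF ht hN hw hz
    (ψ := fun p => inner ℝ u (k (massBall (F t) q.1 (dist q.1 p.1)) • (p.2 - q.2)))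
    (c := ‖u‖ * fieldLip E L K₀ B Q R) (by positivity)
    (hi₁.const_inner u).aestronglyMeasurable (fun p hp p' hp' => by
      rw [← inner_sub_right]
      refine (abs_real_inner_le_norm _ _).trans ?_
      rw [mul_assoc]
      gcongr
      refine (norm_integrand_sub_le hk hB (hf.isBoxMeasure ht) (hF t ht) hq.1 hq.1 hq.2 hp
        hp').trans ?_
      rw [dist_self, dist_self, mul_zero, zero_add, add_zero, fieldLip, add_mul]
      have h1 : dist p.1 p'.1 ≤ dist p p' := le_max_left _ _
      have h2 : dist p.2 p'.2 ≤ dist p p' := le_max_right _ _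
      have h3 : 0 ≤ 2 * R * (L * massLip E B Q R) := by positivity
      have h4 := mul_le_mul_of_nonneg_left h1 h3
      have h5 := mul_le_mul_of_nonneg_left h2 hK.le
      have h6 := mul_nonneg h3 (dist_nonneg (x := p) (y := p'))
      linarith)
  rw [integral_inner hi₁, integral_inner hi₂, ← inner_sub_right] at key
  change |inner ℝ u u| ≤ _ at key
  rw [real_inner_self_eq_norm_sq, abs_of_nonneg (by positivity), sq, mul_assoc] at key
  exact le_of_mul_le_mul_left key hupos

/-- Stability of the mean-field flow against its empirical intermediate dynamics. -/
theorem W1_le (hf : IsConfinedFlow k T μ₀ F Z Rx Rv Q R) (hk : IsCommKernel k K₁ K₀ L)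
    (hB : 0 ≤ B) (hF : ∀ t ∈ Icc 0 T, F t ≤ ENNReal.ofReal B • volume) (hN : 0 < N)
    {z : ℝ → Fin N → E × E} (hz : IsParticleSystem k T F z)
    (h0 : ∀ i, z 0 i ∈ closedBall (0 : E) Rx ×ˢ closedBall (0 : E) Rv)
    (hbox : ∀ t ∈ Icc 0 T, ∀ i, z t i ∈ closedBall (0 : E) Q ×ˢ closedBall (0 : E) R)
    {Λ : ℝ} (hΛ : Λ = fieldLip E L K₀ B Q R) {t : ℝ} (ht : t ∈ Icc 0 T) :
    W1 (F t) (empMeasure (z t)) ≤ (Real.exp ((1 + Λ) * T) +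
      Λ * Real.exp ((1 + Λ) * T) / (1 + 2 * Λ) * (Real.exp ((1 + 2 * Λ) * T) - 1)) *
        W1 μ₀ (empMeasure (z 0)) := by
  subst hΛ
  set Λ := fieldLip E L K₀ B Q R with hΛ
  have hK := hk.upper_pos
  have hR := hf.bound_nonneg
  have := hf.prob
  have := isProbabilityMeasure_empMeasure hN (z 0)
  have hmass := massLip_nonneg (E := E) (R := R) hB
    (dist_nonneg.trans (hbox t ht ⟨0, hN⟩).1)
  have hΛ0 : 0 ≤ Λ := by rw [hΛ, fieldLip]; positivity
  have hbdd : Bornology.IsBounded (closedBall (0 : E) Rx ×ˢ closedBall (0 : E) Rv) :=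
    isBounded_closedBall.prod isBounded_closedBall
  have hW := W1_nonneg hbdd hf.init (ae_empMeasure h0)
  set W := W1 μ₀ (empMeasure (z 0))
  set e := Real.exp ((1 + Λ) * T)
  have hgron := norm_le_gronwallBound_Icc (g := fun τ i => z τ i - Z τ (z 0 i)) (T := T) (δ := 0)
    (A := 1 + 2 * Λ) (ε := Λ * (e * W)) (by positivity) le_rfl (by positivity)
    (fun s hs => hasDerivWithinAt_pi.2 fun i =>
      ((hz.pos s hs i).prodMk (hz.vel s hs i)).sub
        ((hf.pos (z 0 i) s hs).prodMk (hf.vel (z 0 i) s hs)))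
    (by simp only [hf.zero, sub_self]; exact (norm_zero (E := Fin N → E × E)).le) (fun s hs => ?_) ht
  · have hW1 : W1 (F t) (empMeasure (z t)) ≤ e * W + ‖fun i => z t i - Z t (z 0 i)‖ := by
      refine csSup_le ⟨0, fun _ => 0, LipschitzWith.const 0 |>.weaken zero_le_one, ⟨0, by simp⟩,
        by simp⟩ ?_
      rintro a ⟨φ, hφ, -, rfl⟩
      have := hf.abs_integral_sub_empMeasure_le hk hB hF ht hN h0 (hbox t ht) (ψ := φ) one_pos
        hφ.continuous.aestronglyMeasurable (fun p _ q _ => by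
          simpa [Real.dist_eq] using hφ.dist_le_mul p q)
      rw [one_mul] at this
      exact (le_abs_self _).trans this
    rw [gronwallBound_of_K_ne_0 (by positivity)] at hgron
    refine hW1.trans ((add_le_add_right hgron _).trans_eq ?_)
    ring
  · have hD0 := norm_nonneg fun i => z s i - Z s (z 0 i)
    refine (pi_norm_le_iff_of_nonneg (by positivity)).2 fun i => ?_
    have hD : ‖z s i - Z s (z 0 i)‖ ≤ ‖fun i => z s i - Z s (z 0 i)‖ :=
      norm_le_pi_norm (fun i => z s i - Z s (z 0 i)) i
    have hpb := isProbabilityMeasure_empMeasure hN (z s)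
    have hν : IsBoxMeasure (empMeasure (z s)) Q R := ⟨hpb, ae_empMeasure (hbox s hs)⟩
    have hZ := hf.conf _ (h0 i) s hs
    have h1 := norm_topField_sub_le hk hB (hf.isBoxMeasure hs) (hF s hs) hν (hbox s hs i) hZ
    have h2 := hf.norm_topField_sub_empMeasure_le hk hB hF hs hN h0 (hbox s hs) hZ
    rw [dist_eq_norm] at h1
    have h3 := mul_le_mul_of_nonneg_left hD hΛ0
    have h4 := mul_nonneg hΛ0 hD0
    have h5 : 0 ≤ Λ * (e * W) := by positivity
    refine max_le ?_ ?_
    · have h6 : ‖(z s i).2 - (Z s (z 0 i)).2‖ ≤ ‖z s i - Z s (z 0 i)‖ :=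
        norm_snd_le (z s i - Z s (z 0 i))
      change ‖(z s i).2 - (Z s (z 0 i)).2‖ ≤ _
      linarith
    · refine (norm_sub_le_norm_sub_add_norm_sub _
        (topField k (F s) (empMeasure (z s)) (Z s (z 0 i)).1 (Z s (z 0 i)).2) _).trans ?_
      linarith

end IsConfinedFlow

end Comparison

section Stability

variable {E : Type*} [NormedAddCommGroup E] [InnerProductSpace ℝ E] [FiniteDimensional ℝ E]
  [MeasureSpace E] [BorelSpace E] [(volume : Measure E).IsAddHaarMeasure] {k : ℝ → ℝ} {K₁ K₀ : ℝ}
  {L : NNReal}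

/-- Measure flows of bounded density preserve phase-space boxes. -/
theorem IsMeasureFlow.isConfinedFlow {T Rx Rv C Q R : ℝ} {μ₀ : Measure (E × E)}
    {F : ℝ → Measure (E × E)} {Z : ℝ → E × E → E × E} (h : IsMeasureFlow k T μ₀ F Z)
    (hk : IsCommKernel k K₁ K₀ L) (hT : 0 < T) (hRx : 0 ≤ Rx) (hRv : 0 ≤ Rv)
    (hF : ∀ t ∈ Icc 0 T, F t ≤ ENNReal.ofReal C • volume)
    (h0 : ∀ᵐ p ∂μ₀, p ∈ closedBall (0 : E) Rx ×ˢ closedBall (0 : E) Rv)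
    (hR : gronwallBound Rv K₀ (K₀ * (2 ^ ⌈4 * K₀ * T⌉₊ * Rv)) T ≤ R) (hQ : Rx + R * T ≤ Q) :
    IsConfinedFlow k T μ₀ F Z Rx Rv Q R := by
  have := h.prob
  have hK := hk.upper_pos
  have hm0 : ∫⁻ p, ‖p.2‖ₑ ∂μ₀ ≤ ENNReal.ofReal Rv := by
    calc ∫⁻ p, ‖p.2‖ₑ ∂μ₀ ≤ ∫⁻ _, ENNReal.ofReal Rv ∂μ₀ := by
          refine lintegral_mono_ae ?_
          filter_upwards [h0] with p hp
          rw [← ofReal_norm]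
          exact ENNReal.ofReal_le_ofReal (by simpa using hp.2)
      _ = _ := by simp
  have hbdd := h.moment_bounded hk hT ENNReal.ofReal_ne_top hF
    (ne_top_of_le_ne_top ENNReal.ofReal_ne_top hm0)
  have hmom : ∀ t ∈ Icc 0 T, (∫⁻ p, ‖(Z t p).2‖ₑ ∂μ₀).toReal ≤ 2 ^ ⌈4 * K₀ * T⌉₊ * Rv := by
    intro t ht
    have h1 : 4 * K₀ * t ≤ ⌈4 * K₀ * T⌉₊ :=
      (mul_le_mul_of_nonneg_left ht.2 (by positivity)).trans (Nat.le_ceil _)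
    have h2 := (h.moment_le_pow hk hbdd _ t ht h1).trans (mul_le_mul_right hm0 _)
    refine ENNReal.toReal_le_of_le_ofReal (by positivity) (h2.trans_eq ?_)
    rw [ENNReal.ofReal_mul (by positivity), ENNReal.ofReal_pow (by norm_num), ENNReal.ofReal_ofNat]
  have hvel : ∀ p ∈ closedBall (0 : E) Rx ×ˢ closedBall (0 : E) Rv, ∀ t ∈ Icc 0 T,
      ‖(Z t p).2‖ ≤ R := fun p hp t ht =>
    (h.norm_vel_le hk (by positivity) hRv hmom (by simpa using hp.2) ht).trans hR
  exact
    { h with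
      init := h0
      conf := fun p hp t ht => by
        refine ⟨?_, by simpa using hvel p hp t ht⟩
        have := h.norm_pos_le (p := p) (r := Rx) (by simpa using hp.1) (hvel p hp) ht
        rw [mem_closedBall_zero_iff]
        exact this.trans hQ
      pos_le := hQ
      vel_le := (gronwallBound_nonneg' hK.le hRv (by positivity) hT.le).trans hR
      pos_nonneg := hRx
      vel_nonneg := hRv }

/-- The stability constant depends only on the kernel, the time horizon, the initial box and the
bound on the initial density. -/
theorem exists_stability_const (hk : IsCommKernel k K₁ K₀ L) {T Rx Rv B : ℝ} (hT : 0 < T)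
    (hRx : 0 ≤ Rx) (hRv : 0 ≤ Rv) (hB : 0 ≤ B) :
    ∃ C : ℝ, 0 < C ∧ ∀ (μ₀ : Measure (E × E)) (F : ℝ → Measure (E × E)) (Z : ℝ → E × E → E × E),
      IsMeasureFlow k T μ₀ F Z →
      (∃ C : ℝ, 0 ≤ C ∧ ∀ t ∈ Icc 0 T, F t ≤ ENNReal.ofReal C • volume) →
      μ₀ ≤ ENNReal.ofReal B • volume →
      (∀ᵐ p ∂μ₀, p ∈ closedBall (0 : E) Rx ×ˢ closedBall (0 : E) Rv) →
      ∀ (N : ℕ), 0 < N → ∀ z : ℝ → Fin N → E × E, IsParticleSystem k T F z →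
      (∀ i, z 0 i ∈ closedBall (0 : E) Rx ×ˢ closedBall (0 : E) Rv) →
      ∀ t ∈ Icc 0 T, W1 (F t) (empMeasure (z t)) ≤ C * W1 μ₀ (empMeasure (z 0)) := by
  have hK := hk.upper_pos
  set R := max (gronwallBound Rv (2 * K₀) 0 T)
    (gronwallBound Rv K₀ (K₀ * (2 ^ ⌈4 * K₀ * T⌉₊ * Rv)) T) with hR
  set Q := Rx + R * T with hQ
  set B' := B * Real.exp (2 * (T * K₀)) ^ Module.finrank ℝ E with hB'
  set Λ := fieldLip E L K₀ B' Q R with hΛ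
  have hB'0 : 0 ≤ B' := by positivity
  have hR0 : 0 ≤ R := hRv.trans
    ((gronwallBound_nonneg' (by positivity) hRv le_rfl hT.le).trans (le_max_left _ _))
  have hmass := massLip_nonneg (E := E) (R := R) hB'0 (by positivity : 0 ≤ Q)
  have hΛ0 : 0 ≤ Λ := by rw [hΛ, fieldLip]; positivity
  refine ⟨Real.exp ((1 + Λ) * T) + Λ * Real.exp ((1 + Λ) * T) / (1 + 2 * Λ) *
    (Real.exp ((1 + 2 * Λ) * T) - 1), ?_, fun μ₀ F Z h ⟨C, hC, hF⟩ hμ₀ h0 N hN z hz hz0 t ht => ?_⟩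
  rotate_left
  · have hf := h.isConfinedFlow hk hT hRx hRv hF h0 (le_max_right _ _) hQ.ge
    exact hf.W1_le hk hB'0 (fun t ht => hf.le_smul_volume hk hC hF hB hμ₀ ht) hN hz hz0
      (fun t ht i => hz.mem_box hk hN hRv hz0 (le_max_left _ _) hQ.ge ht i) hΛ ht
  · have : 1 ≤ Real.exp ((1 + 2 * Λ) * T) := Real.one_le_exp (by positivity)
    have : 0 ≤ Real.exp ((1 + 2 * Λ) * T) - 1 := by linarith
    positivity

end Stability

section Kernel

/-- A positive decreasing Lipschitz kernel on `[0, 1]`, extended by constants. -/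
theorem isCommKernel_IccExtend {K : ℝ → ℝ} {LK : NNReal} (hpos : ∀ z ∈ Icc (0 : ℝ) 1, 0 < K z)
    (hanti : AntitoneOn K (Icc (0 : ℝ) 1)) (hlip : LipschitzOnWith LK K (Icc (0 : ℝ) 1)) :
    IsCommKernel (IccExtend (zero_le_one (α := ℝ)) fun z => K z) (K 1) (K 0) LK where
  pos := hpos 1 ⟨zero_le_one, le_rfl⟩
  lower z := hanti (projIcc 0 1 zero_le_one z).2 ⟨zero_le_one, le_rfl⟩
    (projIcc 0 1 zero_le_one z).2.2
  upper z := hanti ⟨le_rfl, zero_le_one⟩ (projIcc 0 1 zero_le_one z).2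
    (projIcc 0 1 zero_le_one z).2.1
  lip := by
    have := hlip.to_restrict.comp (LipschitzWith.projIcc (zero_le_one (α := ℝ)))
    rw [mul_one] at this
    exact this

end Kernel

section DensityMeasure

variable {α : Type*} [MeasureSpace α] {g : α → ℝ}

theorem isProbabilityMeasure_withDensity_ofReal (h0 : ∀ p, 0 ≤ g p) (h1 : ∫ p, g p = 1) :
    IsProbabilityMeasure (volume.withDensity fun p => ENNReal.ofReal (g p)) := ⟨by
  rw [withDensity_apply _ MeasurableSet.univ, Measure.restrict_univ,
    ← ofReal_integral_eq_lintegral_ofReal (integrable_of_integral_eq_one h1) (ae_of_all _ h0), h1,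
    ENNReal.ofReal_one]⟩

theorem integral_withDensity_ofReal {G : Type*} [NormedAddCommGroup G] [NormedSpace ℝ G]
    (hg : Measurable g) (h0 : ∀ p, 0 ≤ g p) (φ : α → G) :
    ∫ p, φ p ∂(volume.withDensity fun p => ENNReal.ofReal (g p)) = ∫ p, g p • φ p := by
  rw [integral_withDensity_eq_integral_toReal_smul (by fun_prop)
    (ae_of_all _ fun _ => ENNReal.ofReal_lt_top)]
  simp only [ENNReal.toReal_ofReal (h0 _)]

theorem integrable_withDensity_ofReal_iff {G : Type*} [NormedAddCommGroup G] [NormedSpace ℝ G]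
    (hg : Measurable g) (h0 : ∀ p, 0 ≤ g p) {φ : α → G} :
    Integrable φ (volume.withDensity fun p => ENNReal.ofReal (g p)) ↔
      Integrable fun p => g p • φ p := by
  rw [integrable_withDensity_iff_integrable_smul' (by fun_prop)
    (ae_of_all _ fun _ => ENNReal.ofReal_lt_top)]
  simp only [ENNReal.toReal_ofReal (h0 _)]

theorem withDensity_ofReal_le {B : ℝ} (hB : ∀ᵐ p ∂(volume : Measure α), g p ≤ B) :
    (volume.withDensity fun p => ENNReal.ofReal (g p)) ≤ ENNReal.ofReal B • volume := by
  rw [← withDensity_const]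
  refine withDensity_mono ?_
  filter_upwards [hB] with p hp using ENNReal.ofReal_le_ofReal hp

end DensityMeasure

section Euclidean

variable {d : ℕ} {g : EuclideanSpace ℝ (Fin d) × EuclideanSpace ℝ (Fin d) → ℝ}

theorem Mdens_Smarg (h0 : ∀ p, 0 ≤ g p) (h1 : ∫ p, g p = 1) (x : EuclideanSpace ℝ (Fin d))
    (r : ℝ) : Mdens (Smarg g) x r =
      massBall (volume.withDensity fun p => ENNReal.ofReal (g p)) x r := by
  have hi := integrable_of_integral_eq_one h1
  rw [massBall, measureReal_def, withDensity_apply _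
    (isClosed_closedBall.measurableSet.prod MeasurableSet.univ),
    ← ofReal_integral_eq_lintegral_ofReal hi.integrableOn (ae_of_all _ h0),
    ENNReal.toReal_ofReal (integral_nonneg h0), Measure.volume_eq_prod, setIntegral_prod]
  · simp [Mdens, Smarg]
  · exact hi.integrableOn

theorem WfieldMeas_eq_topField {K : ℝ → ℝ} (h0 : ∀ p, 0 ≤ g p) (h1 : ∫ p, g p = 1)
    (ν : Measure (EuclideanSpace ℝ (Fin d) × EuclideanSpace ℝ (Fin d)))
    (x v : EuclideanSpace ℝ (Fin d)) : WfieldMeas K (Smarg g) ν x v =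
      topField (IccExtend (zero_le_one (α := ℝ)) fun z => K z)
        (volume.withDensity fun p => ENNReal.ofReal (g p)) ν x v := by
  have := isProbabilityMeasure_withDensity_ofReal h0 h1
  rw [WfieldMeas, topField]
  congr 1
  ext1 p
  have hmem : massBall (volume.withDensity fun p => ENNReal.ofReal (g p)) x (dist x p.1) ∈
      Icc (0 : ℝ) 1 := ⟨measureReal_nonneg, measureReal_le_one⟩
  rw [Mdens_Smarg h0 h1, IccExtend_of_mem _ _ hmem]

theorem Wfield_eq_WfieldMeas {K : ℝ → ℝ} (hg : Measurable g) (h0 : ∀ p, 0 ≤ g p)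
    (ρ : EuclideanSpace ℝ (Fin d) → ℝ) (x v : EuclideanSpace ℝ (Fin d)) : Wfield K ρ g x v =
      WfieldMeas K ρ (volume.withDensity fun p => ENNReal.ofReal (g p)) x v := by
  rw [WfieldMeas, integral_withDensity_ofReal hg h0, Wfield]
  congr 1
  ext1 p
  rw [smul_smul, mul_comm]

theorem aemeasurable_of_arctan {α : Type*} [MeasurableSpace α] {μ : Measure α} {u : α → ℝ}
    (h : AEMeasurable (fun p => Real.arctan (u p) + 2) μ) : AEMeasurable u μ := by
  have hm : Measurable fun y : ℝ => Real.sin (y - 2) / Real.cos (y - 2) := by fun_prop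
  refine (hm.comp_aemeasurable h).congr (ae_of_all _ fun p => ?_)
  simp only [Function.comp_apply, add_sub_cancel_right]
  rw [← Real.tan_eq_sin_div_cos, Real.tan_arctan]

/-- A map whose push-forward is tested by bounded continuous functions is almost everywhere
measurable: the integrals of positive test functions would otherwise vanish. -/
theorem aemeasurable_of_forall_integral {f f₀ : EuclideanSpace ℝ (Fin d) ×
      EuclideanSpace ℝ (Fin d) → ℝ}
    {Z : EuclideanSpace ℝ (Fin d) × EuclideanSpace ℝ (Fin d) →
      EuclideanSpace ℝ (Fin d) × EuclideanSpace ℝ (Fin d)}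
    (hf0 : ∀ p, 0 ≤ f p) (hf1 : ∫ p, f p = 1) (hm : Measurable f₀) (h0 : ∀ p, 0 ≤ f₀ p)
    (hZ : ∀ α : EuclideanSpace ℝ (Fin d) × EuclideanSpace ℝ (Fin d) → ℝ, Continuous α →
      (∃ C : ℝ, ∀ p, |α p| ≤ C) → ∫ p, α p * f p = ∫ p, α (Z p) * f₀ p) :
    AEMeasurable Z (volume.withDensity fun p => ENNReal.ofReal (f₀ p)) := by
  have key : ∀ c : EuclideanSpace ℝ (Fin d) × EuclideanSpace ℝ (Fin d) → ℝ, Continuous c →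
      AEMeasurable (fun p => c (Z p)) (volume.withDensity fun p => ENNReal.ofReal (f₀ p)) := by
    intro c hc
    have hi := integrable_of_integral_eq_one hf1
    have hcont : Continuous fun p => Real.arctan (c p) + 2 := by fun_prop
    have hlow : ∀ y, Real.arctan y + 2 ≥ 2 - Real.pi / 2 := fun y => by
      linarith [Real.neg_pi_div_two_lt_arctan y]
    have hb : ∀ p, |Real.arctan (c p) + 2| ≤ 4 := fun p => by
      have h1 := Real.neg_pi_div_two_lt_arctan (c p)
      have h2 := Real.arctan_lt_pi_div_two (c p)
      have h3 := Real.pi_lt_four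
      rw [abs_le]; constructor <;> linarith
    have hpos : (2 - Real.pi / 2) * 1 ≤ ∫ p, (Real.arctan (c p) + 2) * f p := by
      rw [← hf1, ← integral_const_mul]
      refine integral_mono (hi.const_mul _)
        (hi.bdd_mul hcont.aestronglyMeasurable (ae_of_all _ hb)) fun p => ?_
      exact mul_le_mul_of_nonneg_right (hlow _) (hf0 p)
    rw [hZ _ hcont ⟨4, hb⟩] at hpos
    have hint : Integrable fun p => (Real.arctan (c (Z p)) + 2) * f₀ p :=
      Integrable.of_integral_ne_zero (by have := Real.pi_lt_four; linarith)
    refine aemeasurable_of_arctan ?_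
    refine ((integrable_withDensity_ofReal_iff hm h0).2 ?_).aemeasurable
    simpa only [smul_eq_mul, mul_comm] using hint
  have hpi : ∀ c : EuclideanSpace ℝ (Fin d) × EuclideanSpace ℝ (Fin d) → EuclideanSpace ℝ (Fin d),
      Continuous c →
      AEMeasurable (fun p => c (Z p)) (volume.withDensity fun p => ENNReal.ofReal (f₀ p)) := by
    intro c hc
    refine (MeasurableEquiv.toLp 2 (Fin d → ℝ)).measurable.comp_aemeasurable
      (aemeasurable_pi_lambda (fun p i => c (Z p) i) fun i => key (fun q => c q i) ?_)
    fun_prop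
  exact (hpi Prod.fst continuous_fst).prodMk (hpi Prod.snd continuous_snd)

theorem IsWeakSolCS.exists_isMeasureFlow {K : ℝ → ℝ} {T : ℝ}
    {f₀ : EuclideanSpace ℝ (Fin d) × EuclideanSpace ℝ (Fin d) → ℝ}
    {f : ℝ → EuclideanSpace ℝ (Fin d) × EuclideanSpace ℝ (Fin d) → ℝ} (hm : Measurable f₀)
    (h0 : ∀ p, 0 ≤ f₀ p) (h1 : ∫ p, f₀ p = 1) (hf : IsWeakSolCS K T f₀ f) :
    ∃ Z, IsMeasureFlow (IccExtend (zero_le_one (α := ℝ)) fun z => K z) T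
      (volume.withDensity fun p => ENNReal.ofReal (f₀ p))
      (fun t => volume.withDensity fun p => ENNReal.ofReal (f t p)) Z := by
  obtain ⟨hden, -, -, Z, hZ0, hZd, hZm⟩ := hf
  have hprob := isProbabilityMeasure_withDensity_ofReal h0 h1
  have hae : ∀ t ∈ Icc 0 T, AEMeasurable (Z t)
      (volume.withDensity fun p => ENNReal.ofReal (f₀ p)) := fun t ht =>
    aemeasurable_of_forall_integral (hden t ht).2.1 (hden t ht).2.2 hm h0 (hZm t ht)
  refine ⟨Z, hprob, hae, fun t ht => ?_, hZ0, fun p t ht => (hZd p t ht).1, fun p t ht => ?_⟩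
  · obtain ⟨hfm, hf0, hf1⟩ := hden t ht
    have := isProbabilityMeasure_withDensity_ofReal hf0 hf1
    refine ext_of_forall_integral_eq_of_IsFiniteMeasure fun φ => ?_
    rw [integral_map (hae t ht) φ.continuous.aestronglyMeasurable,
      integral_withDensity_ofReal hm h0, integral_withDensity_ofReal hfm hf0]
    have := hZm t ht φ φ.continuous ⟨‖φ‖, fun p => φ.norm_coe_le_norm p⟩
    simpa only [smul_eq_mul, mul_comm] using this.symm
  · obtain ⟨hfm, hf0, hf1⟩ := hden t ht
    rw [← WfieldMeas_eq_topField hf0 hf1, ← Wfield_eq_WfieldMeas hfm hf0]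
    exact (hZd p t ht).2

end Euclidean

/-- Comparison of the mean-field solution with the intermediate
particle dynamics: if `(X^f_i,V^f_i)` solve `Ẋ^f_i = V^f_i`,
`V̇^f_i = W[Sf_t,ν^N_t](X^f_i,V^f_i)` with `ν^N_t` their empirical measure, then
`W₁(f_t,ν^N_t) ≤ C(T) W₁(f₀,μ^N₀)` on `[0,T]`, with `C(T)` depending only on `T`,
`R_x`, `R_v` and `‖f₀‖_∞`. -/
theorem intermediate_dynamics_W1_estimate {d : ℕ} (K : ℝ → ℝ)
    (hKpos : ∀ z ∈ Set.Icc (0:ℝ) 1, 0 < K z)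
    (hKanti : AntitoneOn K (Set.Icc (0:ℝ) 1))
    (LK : NNReal) (hKlip : LipschitzOnWith LK K (Set.Icc (0:ℝ) 1))
    (T Rx Rv B : ℝ) (hT : 0 < T) (hRx : 0 < Rx) (hRv : 0 < Rv) (hB : 0 < B) :
    ∃ C : ℝ, 0 < C ∧
      ∀ (f₀ : EuclideanSpace ℝ (Fin d) × EuclideanSpace ℝ (Fin d) → ℝ),
        Measurable f₀ → (∀ p, 0 ≤ f₀ p) → (∫ p, f₀ p) = 1 →
        (∀ᵐ p ∂volume, f₀ p ≤ B) →
        (∀ p, f₀ p ≠ 0 → p ∈ closedBall (0 : EuclideanSpace ℝ (Fin d)) Rx ×ˢ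
          closedBall (0 : EuclideanSpace ℝ (Fin d)) Rv) →
      ∀ (f : ℝ → EuclideanSpace ℝ (Fin d) × EuclideanSpace ℝ (Fin d) → ℝ),
        IsWeakSolCS K T f₀ f →
      ∀ (N : ℕ), 0 < N →
      ∀ (x v : Fin N → EuclideanSpace ℝ (Fin d)),
        (∀ i, x i ∈ closedBall (0 : EuclideanSpace ℝ (Fin d)) Rx) →
        (∀ i, v i ∈ closedBall (0 : EuclideanSpace ℝ (Fin d)) Rv) →
      ∀ (Xf Vf : Fin N → ℝ → EuclideanSpace ℝ (Fin d)),
        (∀ i, Xf i 0 = x i ∧ Vf i 0 = v i) →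
        (∀ t ∈ Set.Icc 0 T, ∀ i,
          HasDerivWithinAt (Xf i) (Vf i t) (Set.Icc 0 T) t ∧
          HasDerivWithinAt (Vf i)
            (WfieldMeas K (Smarg (f t))
              (empPair (fun k => Xf k t) (fun k => Vf k t)) (Xf i t) (Vf i t))
            (Set.Icc 0 T) t) →
      ∀ t ∈ Set.Icc 0 T,
        W1 (volume.withDensity fun p => ENNReal.ofReal (f t p))
            (empPair (fun k => Xf k t) (fun k => Vf k t)) ≤
          C * W1 (volume.withDensity fun p => ENNReal.ofReal (f₀ p)) (empPair x v) := by
  obtain ⟨C, hC, hstab⟩ := exists_stability_const (E := EuclideanSpace ℝ (Fin d))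
    (isCommKernel_IccExtend hKpos hKanti hKlip) hT hRx.le hRv.le hB.le
  refine ⟨C, hC, fun f₀ hm h0 h1 hfB hsupp f hf N hN x v hx hv Xf Vf hinit hder t ht => ?_⟩
  obtain ⟨Z, hZ⟩ := hf.exists_isMeasureFlow hm h0 h1
  obtain ⟨hden, ⟨Cf, hCf⟩, -, -⟩ := hf
  have hx0 : (fun i => Xf i 0) = x := funext fun i => (hinit i).1
  have hv0 : (fun i => Vf i 0) = v := funext fun i => (hinit i).2
  have := hstab _ _ Z hZ
    ⟨max Cf 0, le_max_right _ _, fun s hs => withDensity_ofReal_le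
      ((hCf s hs).mono fun p hp => hp.trans (le_max_left _ _))⟩
    (withDensity_ofReal_le hfB)
    ((ae_withDensity_iff (by fun_prop)).2 (ae_of_all _ fun p hp => hsupp p fun h => hp (by simp [h])))
    N hN (fun s i => (Xf i s, Vf i s))
    ⟨fun s hs i => (hder s hs i).1, fun s hs i => by
      rw [← WfieldMeas_eq_topField (hden s hs).2.1 (hden s hs).2.2]
      exact (hder s hs i).2⟩
    (fun i => ⟨by simpa [(hinit i).1] using hx i, by simpa [(hinit i).2] using hv i⟩) t ht
  change _ ≤ C * W1 _ (empPair (fun i => Xf i 0) (fun i => Vf i 0)) at this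
  rw [hx0, hv0] at this
  exact this
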